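/- arXiv:0711.0131 — 2 statements merged into one kernel-verified Lean document; each statement's English description precedes it below -/
import Mathlib

section
/- Let A₁ and A₂ be C*-algebras with A₂ unital, let C be a masa of A₁ with the extension property, and let A₁ ⊗_β A₂ be any C*-completion of the algebraic tensor product. Then the relative commutant of C ⊗ 1 in A₁ ⊗_β A₂ equals the closure of C ⊙ A₂, i.e., (C ⊗ 1)^c = C ⊗ A₂. -/
set_option maxHeartbeats 1000000
set_option synthInstance.maxHeartbeats 1000000

open scoped ComplexOrder TensorProduct

noncomputable section

/-- A state on a (possibly non-unital) normed star algebra: a norm-one positive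
continuous linear functional. -/
def IsState {A : Type*} [NonUnitalNormedRing A] [StarRing A] [NormedSpace ℂ A]
    (φ : A →L[ℂ] ℂ) : Prop :=
  ‖φ‖ = 1 ∧ ∀ a : A, 0 ≤ φ (star a * a)

/-- A pure state: a state which is an extreme point of the state space. -/
def IsPureState {A : Type*} [NonUnitalNormedRing A] [StarRing A] [NormedSpace ℂ A]
    (φ : A →L[ℂ] ℂ) : Prop :=
  IsState φ ∧ ∀ (ψ₁ ψ₂ : A →L[ℂ] ℂ) (t : ℝ), IsState ψ₁ → IsState ψ₂ → 0 < t → t < 1 →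
    φ = (t : ℂ) • ψ₁ + ((1 : ℂ) - (t : ℂ)) • ψ₂ → ψ₁ = φ ∧ ψ₂ = φ

/-- A maximal abelian self-adjoint subalgebra (masa) of a (possibly non-unital)
C*-algebra: an abelian *-subalgebra equal to its own relative commutant. -/
def IsMasa {A : Type*} [NonUnitalCStarAlgebra A] (C : NonUnitalStarSubalgebra ℂ A) : Prop :=
  (∀ x ∈ C, ∀ y ∈ C, x * y = y * x) ∧ ∀ x : A, (∀ c ∈ C, c * x = x * c) → x ∈ C

/-- A masa of a unital C*-algebra (unital version). -/
def IsMasaU {A : Type*} [CStarAlgebra A] (C : StarSubalgebra ℂ A) : Prop :=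
  (∀ x ∈ C, ∀ y ∈ C, x * y = y * x) ∧ ∀ x : A, (∀ c ∈ C, c * x = x * c) → x ∈ C

/-- The Kadison-Singer extension property for a subalgebra of a possibly non-unital
C*-algebra: (i) every pure state (character) of `C` has a unique pure state extension
to `A`, and (ii) no pure state of `A` annihilates `C`. -/
def HasExtensionProperty {A : Type*} [NonUnitalCStarAlgebra A]
    (C : NonUnitalStarSubalgebra ℂ A) : Prop :=
  (∀ χ : ↥C →L[ℂ] ℂ, IsPureState χ →
      ∃! φ : A →L[ℂ] ℂ, IsPureState φ ∧ ∀ c : ↥C, φ ↑c = χ c) ∧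
  ∀ φ : A →L[ℂ] ℂ, IsPureState φ → ∃ c ∈ C, φ c ≠ 0

/-- The extension property for a unital subalgebra of a unital C*-algebra: every pure
state (character) of `C` has a unique pure state extension to `A`. -/
def HasExtensionPropertyU {A : Type*} [CStarAlgebra A] (C : StarSubalgebra ℂ A) : Prop :=
  ∀ χ : ↥C →L[ℂ] ℂ, IsPureState χ →
    ∃! φ : A →L[ℂ] ℂ, IsPureState φ ∧ ∀ c : ↥C, φ ↑c = χ c

/-- A C*-completion `T` of the algebraic tensor product `A₁ ⊙ A₂` with respect to a
C*-norm `β`: a C*-algebra together with commuting isometric embeddings of the factors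
such that the induced map on the algebraic tensor product is injective (i.e. the norm
of `T` restricts to a genuine C*-norm on `A₁ ⊙ A₂`) and has dense range. -/
structure CStarCompletion (A₁ A₂ T : Type*) [NonUnitalCStarAlgebra A₁]
    [NonUnitalCStarAlgebra A₂] [NonUnitalCStarAlgebra T] where
  ι₁ : A₁ →⋆ₙₐ[ℂ] T
  ι₂ : A₂ →⋆ₙₐ[ℂ] T
  isometry₁ : Isometry ι₁
  isometry₂ : Isometry ι₂
  commutes : ∀ (a : A₁) (b : A₂), ι₁ a * ι₂ b = ι₂ b * ι₁ a
  injective : ∀ (n : ℕ) (a : Fin n → A₁) (b : Fin n → A₂),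
      (∑ i, ι₁ (a i) * ι₂ (b i)) = 0 → (∑ i, a i ⊗ₜ[ℂ] b i : A₁ ⊗[ℂ] A₂) = 0
  dense_span : Dense (Submodule.span ℂ {x : T | ∃ a b, x = ι₁ a * ι₂ b} : Set T)

/-- The closure, in a C*-completion `T` of `A₁ ⊙ A₂`, of the linear span of the
elementary tensors `c₁ ⊗ c₂` with `cᵢ` in given subsets of the factors: this is the
canonical copy of `C₁ ⊗ C₂` inside `A₁ ⊗_β A₂`. -/
def tensorSet {A₁ A₂ T : Type*} [NonUnitalCStarAlgebra A₁] [NonUnitalCStarAlgebra A₂]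
    [NonUnitalCStarAlgebra T] (K : CStarCompletion A₁ A₂ T)
    (S₁ : Set A₁) (S₂ : Set A₂) : Set T :=
  closure (Submodule.span ℂ {x : T | ∃ a ∈ S₁, ∃ b ∈ S₂, x = K.ι₁ a * K.ι₂ b} : Set T)

/-- The canonical copy of `C₁ ⊗ C₂` inside `A₁ ⊗_β A₂`, as a closed non-unital
star subalgebra. -/
def tensorSubalg {A₁ A₂ T : Type*} [NonUnitalCStarAlgebra A₁] [NonUnitalCStarAlgebra A₂]
    [NonUnitalCStarAlgebra T] (K : CStarCompletion A₁ A₂ T)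
    (C₁ : NonUnitalStarSubalgebra ℂ A₁) (C₂ : NonUnitalStarSubalgebra ℂ A₂) :
    NonUnitalStarSubalgebra ℂ T :=
  (NonUnitalStarAlgebra.adjoin ℂ
    {x : T | ∃ a ∈ C₁, ∃ b ∈ C₂, x = K.ι₁ a * K.ι₂ b}).topologicalClosure

/-- A (two-sided) bounded approximate identity indexed by a directed set. -/
def IsApproxIdentity {A : Type*} [NonUnitalCStarAlgebra A] {ι : Type}
    [Preorder ι] (e : ι → A) : Prop :=
  (∀ i, ‖e i‖ ≤ 1) ∧ ∀ a : A,
    Filter.Tendsto (fun i => e i * a) Filter.atTop (nhds a) ∧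
    Filter.Tendsto (fun i => a * e i) Filter.atTop (nhds a)

/-- `S` contains a bounded approximate identity for `A`. -/
def ContainsApproxIdentity {A : Type*} [NonUnitalCStarAlgebra A] (S : Set A) : Prop :=
  ∃ (ι : Type) (_ : SemilatticeSup ι) (_ : Nonempty ι) (e : ι → A),
    (∀ i, e i ∈ S) ∧ IsApproxIdentity e

open CStarAlgebra Unitization

lemma map_star_of_positive {A : Type*} [NonUnitalCStarAlgebra A] (ψ : A →ₗ[ℂ] ℂ)
    (hψ : ∀ a, 0 ≤ ψ (star a * a)) (a : A) : ψ (star a) = star (ψ a) := by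
  let _ := CStarAlgebra.spectralOrder A
  have := CStarAlgebra.spectralOrderedRing A
  let f : A →ₚ[ℂ] ℂ := .mk₀ ψ fun x hx => by
    obtain ⟨s, rfl⟩ := CStarAlgebra.nonneg_iff_eq_star_mul_self.mp hx
    exact hψ s
  exact map_star f a

/-- The Cauchy–Schwarz inequality for a positive functional on a C⋆-algebra. -/
lemma norm_apply_star_mul_sq_le {A : Type*} [NonUnitalCStarAlgebra A] (ψ : A →ₗ[ℂ] ℂ)
    (hψ : ∀ a, 0 ≤ ψ (star a * a)) (a b : A) :
    ‖ψ (star a * b)‖ ^ 2 ≤ (ψ (star a * a)).re * (ψ (star b * b)).re := by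
  let _ := CStarAlgebra.spectralOrder A
  have := CStarAlgebra.spectralOrderedRing A
  let f : A →ₚ[ℂ] ℂ := .mk₀ ψ fun x hx => by
    obtain ⟨s, rfl⟩ := CStarAlgebra.nonneg_iff_eq_star_mul_self.mp hx
    exact hψ s
  have h := norm_inner_le_norm (𝕜 := ℂ) (f.toPreGNS a) (f.toPreGNS b)
  have hsq (x : A) : ‖f.toPreGNS x‖ ^ 2 = (ψ (star x * x)).re := by
    have := congrArg Complex.re (f.preGNS_norm_sq (f.toPreGNS x))
    rw [← Complex.ofReal_pow, Complex.ofReal_re] at this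
    exact this
  rw [← hsq, ← hsq, ← mul_pow]
  exact pow_le_pow_left₀ (norm_nonneg _) h 2

/-- A state on a non-unital C⋆-algebra satisfies Kadison's inequality. -/
lemma IsState.norm_sq_le {A : Type*} [NonUnitalCStarAlgebra A] {ψ : A →L[ℂ] ℂ}
    (hψ : IsState ψ) (a : A) : ‖ψ a‖ ^ 2 ≤ (ψ (star a * a)).re := by
  let _ := CStarAlgebra.spectralOrder A
  have := CStarAlgebra.spectralOrderedRing A
  have hl := CStarAlgebra.increasingApproximateUnit A
  have hlim : Filter.Tendsto (fun e : A => ‖ψ (e * a)‖ ^ 2) (CStarAlgebra.approximateUnit A)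
      (nhds (‖ψ a‖ ^ 2)) :=
    ((ψ.continuous.tendsto a).comp (hl.tendsto_mul_right a)).norm.pow 2
  refine le_of_tendsto hlim ?_
  filter_upwards [hl.eventually_norm, hl.eventually_star_eq] with e he hse
  have h := norm_apply_star_mul_sq_le (ψ : A →ₗ[ℂ] ℂ) hψ.2 e a
  simp only [ContinuousLinearMap.coe_coe, hse] at h
  have h1 : (ψ (e * e)).re ≤ 1 := by
    calc (ψ (e * e)).re ≤ ‖ψ (e * e)‖ := Complex.re_le_norm _
      _ ≤ ‖ψ‖ * ‖e * e‖ := ψ.le_opNorm _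
      _ ≤ 1 * (1 * 1) := by
        rw [hψ.1]
        gcongr
        exact (norm_mul_le e e).trans (mul_le_mul he he (norm_nonneg _) zero_le_one)
      _ = 1 := by norm_num
  have h2 : 0 ≤ (ψ (star a * a)).re := (Complex.le_def.mp (hψ.2 a)).1
  nlinarith

/-- A positive functional taking the value one at the unit is contractive. -/
lemma norm_apply_le_of_positive {B : Type*} [CStarAlgebra B] (ω : B →ₗ[ℂ] ℂ) (h1 : ω 1 = 1)
    (hω : ∀ b, 0 ≤ ω (star b * b)) (b : B) : ‖ω b‖ ≤ ‖b‖ := by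
  let _ := CStarAlgebra.spectralOrder B
  have := CStarAlgebra.spectralOrderedRing B
  have h := norm_apply_star_mul_sq_le ω hω 1 b
  simp only [star_one, one_mul, h1, Complex.one_re] at h
  obtain ⟨s, hs⟩ := CStarAlgebra.nonneg_iff_eq_star_mul_self.mp
    (sub_nonneg.mpr (CStarAlgebra.star_mul_le_algebraMap_norm_sq (a := b)))
  have h2 := (Complex.le_def.mp (hω s)).1
  rw [← hs, map_sub, IsScalarTower.algebraMap_apply ℝ ℂ B, Algebra.algebraMap_eq_smul_one,
    map_smul, h1] at h2
  rw [smul_eq_mul, mul_one, Complex.coe_algebraMap, Complex.sub_re, Complex.ofReal_re,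
    Complex.zero_re] at h2
  exact abs_le_of_sq_le_sq' (by linarith) (norm_nonneg _) |>.2

/-- A state on a unital C⋆-algebra, normalised at the unit. -/
def IsUnitalState {B : Type*} [CStarAlgebra B] (ω : B →L[ℂ] ℂ) : Prop :=
  ω 1 = 1 ∧ ∀ b, 0 ≤ ω (star b * b)

lemma IsUnitalState.norm_apply_le {B : Type*} [CStarAlgebra B] {ω : B →L[ℂ] ℂ}
    (hω : IsUnitalState ω) (b : B) : ‖ω b‖ ≤ ‖b‖ :=
  norm_apply_le_of_positive (ω : B →ₗ[ℂ] ℂ) hω.1 hω.2 b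

/-- The inclusion of an algebra in its unitization, as a continuous linear map. -/
def inrCLM (A : Type*) [NonUnitalCStarAlgebra A] : A →L[ℂ] Unitization ℂ A :=
  ⟨inrHom ℂ ℂ A, continuous_inr⟩

@[simp] lemma inrCLM_apply {A : Type*} [NonUnitalCStarAlgebra A] (a : A) :
    inrCLM A a = (a : Unitization ℂ A) := rfl

lemma unitalFunctional_ext {A : Type*} [NonUnitalCStarAlgebra A] {ω₁ ω₂ : Unitization ℂ A →L[ℂ] ℂ}
    (h1 : ω₁ 1 = ω₂ 1) (h : ∀ a : A, ω₁ a = ω₂ a) : ω₁ = ω₂ := by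
  ext x
  induction x with
  | inl_add_inr r a =>
    rw [map_add, map_add, h, show (inl r : Unitization ℂ A) = r • 1 by
      rw [← inl_one, ← inl_smul, smul_eq_mul, mul_one], map_smul, map_smul, h1]

/-- A positive functional on an algebra satisfying Kadison's inequality extends to a state of
the unitization. -/
lemma exists_isUnitalState_of_norm_sq_le {A : Type*} [NonUnitalCStarAlgebra A] (ψ : A →L[ℂ] ℂ)
    (h : ∀ a, ‖ψ a‖ ^ 2 ≤ (ψ (star a * a)).re) (hpos : ∀ a, 0 ≤ ψ (star a * a)) :
    ∃ ω : Unitization ℂ A →L[ℂ] ℂ, IsUnitalState ω ∧ ∀ a : A, ω a = ψ a := by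
  let ω₀ : Unitization ℂ A →ₗ[ℂ] ℂ :=
    { toFun := fun x => x.fst + ψ x.snd
      map_add' := fun x y => by simp; ring
      map_smul' := fun r x => by simp; ring }
  have hω₀ (x) : ω₀ x = x.fst + ψ x.snd := rfl
  have h1 : ω₀ 1 = 1 := by simp [hω₀]
  have hp (b) : 0 ≤ ω₀ (star b * b) := by
    induction b with
    | inl_add_inr r a =>
      have hstar : ψ (star a) = star (ψ a) :=
        map_star_of_positive (ψ : A →ₗ[ℂ] ℂ) hpos a
      have ha := Complex.le_def.mp (hpos a)
      have hb := h a
      rw [Complex.sq_norm, Complex.normSq_apply] at hb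
      simp only [hω₀]
      rw [Complex.le_def]
      simp [hstar] at ha ⊢
      constructor
      · nlinarith [sq_nonneg (r.re + (ψ a).re), sq_nonneg (r.im + (ψ a).im)]
      · rw [← ha.2]; ring
  refine ⟨ω₀.mkContinuous 1 fun b => by
    simpa using norm_apply_le_of_positive ω₀ h1 hp b, ⟨h1, hp⟩, fun a => ?_⟩
  simp [hω₀]

lemma IsUnitalState.eq_of_convexCombination {D B : Type*} [CommCStarAlgebra D] [CStarAlgebra B]
    (j : D →⋆ₐ[ℂ] B) (τ : WeakDual.characterSpace ℂ D) {ω₁ ω₂ : B →L[ℂ] ℂ} {t : ℝ}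
    (h₁ : IsUnitalState ω₁) (h₂ : IsUnitalState ω₂) (ht0 : 0 < t) (ht1 : t < 1)
    (h : ∀ d, τ d = t * ω₁ (j d) + (1 - t) * ω₂ (j d)) (d : D) : ω₁ (j d) = τ d := by
  set e : D := d - algebraMap ℂ D (τ d) with he
  have hτe : τ e = 0 := by simp [he, AlgHomClass.commutes]
  have h0 := h (star e * e)
  rw [map_mul, hτe, mul_zero, map_mul, map_star] at h0
  have hp₁ := Complex.le_def.mp (h₁.2 (j e))
  have hp₂ := Complex.le_def.mp (h₂.2 (j e))
  have hre := congrArg Complex.re h0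
  simp at hre hp₁ hp₂
  have hz : (ω₁ (star (j e) * j e)).re = 0 := by
    nlinarith [mul_nonneg ht0.le hp₁.1, mul_nonneg (sub_nonneg.mpr ht1.le) hp₂.1]
  have hcs := norm_apply_star_mul_sq_le (ω₁ : B →ₗ[ℂ] ℂ) h₁.2 1 (j e)
  simp only [ContinuousLinearMap.coe_coe, hz, mul_zero, star_one, one_mul] at hcs
  have hj : ω₁ (j e) = 0 := by
    rw [← norm_eq_zero]
    nlinarith [norm_nonneg (ω₁ (j e))]
  rw [he, map_sub, map_sub, AlgHomClass.commutes, Algebra.algebraMap_eq_smul_one, map_smul, h₁.1,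
    smul_eq_mul, mul_one, sub_eq_zero] at hj
  exact hj

/-- Extreme points of the state space of a unital C⋆-algebra. -/
def IsExtremeState {B : Type*} [CStarAlgebra B] (ω : B →L[ℂ] ℂ) : Prop :=
  IsUnitalState ω ∧ ∀ (ω₁ ω₂ : B →L[ℂ] ℂ) (t : ℝ), IsUnitalState ω₁ → IsUnitalState ω₂ →
    0 < t → t < 1 → ω = (t : ℂ) • ω₁ + ((1 : ℂ) - (t : ℂ)) • ω₂ → ω₁ = ω ∧ ω₂ = ω

lemma IsState.exists_isUnitalState {A : Type*} [NonUnitalCStarAlgebra A] {ψ : A →L[ℂ] ℂ}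
    (hψ : IsState ψ) : ∃ ω : Unitization ℂ A →L[ℂ] ℂ, IsUnitalState ω ∧ ∀ a : A, ω a = ψ a :=
  exists_isUnitalState_of_norm_sq_le ψ hψ.norm_sq_le hψ.2

lemma IsUnitalState.restrict_nonneg {A : Type*} [NonUnitalCStarAlgebra A]
    {ω : Unitization ℂ A →L[ℂ] ℂ} (hω : IsUnitalState ω) (a : A) :
    0 ≤ (ω ∘L inrCLM A) (star a * a) := by
  simpa using hω.2 (a : Unitization ℂ A)

/-- An extreme state of the unitization restricts to a pure state unless it vanishes on the
algebra. -/
lemma IsExtremeState.isPureState {A : Type*} [NonUnitalCStarAlgebra A]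
    {ω : Unitization ℂ A →L[ℂ] ℂ} (hω : IsExtremeState ω) (h : ∃ a : A, ω a ≠ 0) :
    IsPureState (ω ∘L inrCLM A) := by
  obtain ⟨a, ha⟩ := h
  set ψ := ω ∘L inrCLM A with hψ
  have hψa (a : A) : ψ a = ω a := rfl
  have hne : ψ ≠ 0 := fun h0 => ha (by rw [← hψa, h0, zero_apply])
  have hr0 : 0 < ‖ψ‖ := norm_pos_iff.mpr hne
  have hr1 : ‖ψ‖ ≤ 1 := ψ.opNorm_le_bound zero_le_one fun a => by
    simpa [hψa, norm_inr] using hω.1.norm_apply_le (a : Unitization ℂ A)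
  have hr : ‖ψ‖ = 1 := by
    by_contra hr
    have hlt := lt_of_le_of_ne hr1 hr
    have hst : IsState (((‖ψ‖⁻¹ : ℝ) : ℂ) • ψ) := by
      refine ⟨by rw [norm_smul]; simp [hr0.ne'], fun a => ?_⟩
      rw [smul_apply, smul_eq_mul]
      exact mul_nonneg (by exact_mod_cast (inv_nonneg.mpr hr0.le)) (hω.1.restrict_nonneg a)
    obtain ⟨ω₁, h₁, hext₁⟩ := hst.exists_isUnitalState
    obtain ⟨ω₂, h₂, hext₂⟩ := exists_isUnitalState_of_norm_sq_le (0 : A →L[ℂ] ℂ) (by simp) (by simp)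
    have := (hω.2 ω₁ ω₂ ‖ψ‖ h₁ h₂ hr0 hlt <| unitalFunctional_ext
      (by simp [h₁.1, h₂.1, hω.1.1]) fun a => by
        have : ((‖ψ‖ : ℝ) : ℂ) ≠ 0 := by exact_mod_cast hr0.ne'
        simp [hext₁, hext₂, hψa, this]).2
    apply ha
    rw [← this, hext₂, zero_apply]
  refine ⟨⟨hr, hω.1.restrict_nonneg⟩, fun ψ₁ ψ₂ t hs₁ hs₂ ht0 ht1 heq => ?_⟩
  obtain ⟨ω₁, h₁, hext₁⟩ := hs₁.exists_isUnitalState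
  obtain ⟨ω₂, h₂, hext₂⟩ := hs₂.exists_isUnitalState
  obtain ⟨rfl, he₂⟩ := hω.2 ω₁ ω₂ t h₁ h₂ ht0 ht1 <| unitalFunctional_ext
    (by simp [h₁.1, h₂.1, hω.1.1]) fun a => by
      rw [← hψa, heq]
      simp [hext₁, hext₂]
  constructor
  · ext a
    rw [hψa, hext₁]
  · ext a
    rw [hψa, ← he₂, hext₂]

/-- A state of a commutative C⋆-algebra which is a character is extreme. -/
lemma isExtremeState_of_character {D : Type*} [CommCStarAlgebra D]
    (τ : WeakDual.characterSpace ℂ D) : IsExtremeState (WeakDual.CharacterSpace.toCLM τ) := by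
  have hτ : IsUnitalState (WeakDual.CharacterSpace.toCLM τ) := by
    refine ⟨map_one τ, fun d => ?_⟩
    change 0 ≤ τ (star d * d)
    rw [map_mul, map_star]
    exact star_mul_self_nonneg _
  refine ⟨hτ, fun ω₁ ω₂ t h₁ h₂ ht0 ht1 h => ?_⟩
  have hd (d : D) : τ d = t * ω₁ d + (1 - t) * ω₂ d := congrArg (fun f => f d) h
  constructor
  · ext d
    exact IsUnitalState.eq_of_convexCombination (StarAlgHom.id ℂ D) τ h₁ h₂ ht0 ht1 hd d
  · ext d
    refine IsUnitalState.eq_of_convexCombination (StarAlgHom.id ℂ D) τ (t := 1 - t) h₂ h₁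
      (by linarith) (by linarith) (fun d => ?_) d
    rw [hd]
    push_cast
    simp [add_comm]

/-- The extension property of `HasExtensionProperty`, for an embedded commutative C⋆-algebra. -/
def EmbeddingHasExtensionProperty {A C : Type*} [NonUnitalCStarAlgebra A]
    [NonUnitalCommCStarAlgebra C] (i : C →⋆ₙₐ[ℂ] A) : Prop :=
  (∀ χ : C →L[ℂ] ℂ, IsPureState χ →
      ∃! φ : A →L[ℂ] ℂ, IsPureState φ ∧ ∀ c, φ (i c) = χ c) ∧
  ∀ φ : A →L[ℂ] ℂ, IsPureState φ → ∃ c, φ (i c) ≠ 0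

lemma EmbeddingHasExtensionProperty.extremeState_unique {A C : Type*} [NonUnitalCStarAlgebra A]
    [NonUnitalCommCStarAlgebra C] {i : C →⋆ₙₐ[ℂ] A} (hi : EmbeddingHasExtensionProperty i)
    (τ : WeakDual.characterSpace ℂ (Unitization ℂ C)) {ω ω' : Unitization ℂ A →L[ℂ] ℂ}
    (hω : IsExtremeState ω) (hω' : IsExtremeState ω')
    (h : ∀ d, ω (starMap i d) = τ d) (h' : ∀ d, ω' (starMap i d) = τ d) : ω = ω' := by
  refine unitalFunctional_ext (hω.1.1.trans hω'.1.1.symm) ?_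
  have key {ω : Unitization ℂ A →L[ℂ] ℂ} (h : ∀ d, ω (starMap i d) = τ d) (c : C) :
      ω (i c : A) = τ c := by rw [← h, starMap_inr]
  by_cases hc : ∃ c : C, τ (c : Unitization ℂ C) ≠ 0
  · have hχ := (isExtremeState_of_character τ).isPureState hc
    obtain ⟨c, hc⟩ := hc
    obtain ⟨φ, -, hφ⟩ := hi.1 _ hχ
    have hp {ω : Unitization ℂ A →L[ℂ] ℂ} (hω : IsExtremeState ω)
        (h : ∀ d, ω (starMap i d) = τ d) : ω ∘L inrCLM A = φ :=
      hφ _ ⟨hω.isPureState ⟨i c, by rwa [key h]⟩, key h⟩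
    intro a
    exact congrArg (fun f => f a) ((hp hω h).trans (hp hω' h').symm)
  · push Not at hc
    have hz {ω : Unitization ℂ A →L[ℂ] ℂ} (hω : IsExtremeState ω)
        (h : ∀ d, ω (starMap i d) = τ d) (a : A) : ω a = 0 := by
      by_contra ha
      obtain ⟨c, hc'⟩ := hi.2 _ (hω.isPureState ⟨a, ha⟩)
      exact hc' ((key h c).trans (hc c))
    intro a
    rw [hz hω h, hz hω' h']

lemma EmbeddingHasExtensionProperty.state_unique {A C : Type*} [NonUnitalCStarAlgebra A]
    [NonUnitalCommCStarAlgebra C] {i : C →⋆ₙₐ[ℂ] A} (hi : EmbeddingHasExtensionProperty i)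
    (τ : WeakDual.characterSpace ℂ (Unitization ℂ C)) {ω ω' : Unitization ℂ A →L[ℂ] ℂ}
    (hω : IsUnitalState ω) (hω' : IsUnitalState ω')
    (h : ∀ d, ω (starMap i d) = τ d) (h' : ∀ d, ω' (starMap i d) = τ d) : ω = ω' := by
  let S : Set (WeakDual ℂ (Unitization ℂ A)) :=
    {ω | IsUnitalState (WeakDual.toStrongDual ω) ∧ ∀ d, ω (starMap i d) = τ d}
  have hcl : IsClosed S := by
    have : S = {ω | ω 1 = 1} ∩ (⋂ b, {ω | 0 ≤ ω (star b * b)}) ∩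
        ⋂ d, {ω | ω (starMap i d) = τ d} := by
      ext ω
      simp [S, IsUnitalState]
    rw [this]
    refine ((isClosed_eq (WeakDual.eval_continuous _) continuous_const).inter
      (isClosed_iInter fun b => ?_)).inter
      (isClosed_iInter fun d => isClosed_eq (WeakDual.eval_continuous _) continuous_const)
    exact isClosed_le continuous_const (WeakDual.eval_continuous _)
  have hcomp : IsCompact S := by
    refine (WeakDual.isCompact_closedBall (0 : StrongDual ℂ (Unitization ℂ A)) 1).of_isClosed_subset
      hcl fun ω hω => ?_
    simp only [Set.mem_preimage, Metric.mem_closedBall, dist_zero_right]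
    exact ContinuousLinearMap.opNorm_le_bound _ zero_le_one fun b => by
      simpa using hω.1.norm_apply_le b
  let S' : Set (Unitization ℂ A → ℂ) := (fun ω : WeakDual ℂ (Unitization ℂ A) => ⇑ω) '' S
  have hcomp' : IsCompact S' :=
    hcomp.image (continuous_pi fun b => WeakDual.eval_continuous b)
  have hconv : Convex ℝ S' := by
    rintro _ ⟨ω₁, h₁, rfl⟩ _ ⟨ω₂, h₂, rfl⟩ a b ha hb hab
    have hab' : (a : ℂ) + b = 1 := by exact_mod_cast hab
    refine ⟨(a : ℂ) • ω₁ + (b : ℂ) • ω₂, ⟨⟨?_, fun x => ?_⟩, fun d => ?_⟩, ?_⟩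
    · have e1 : ω₁ 1 = 1 := h₁.1.1
      have e2 : ω₂ 1 = 1 := h₂.1.1
      change (a : ℂ) * ω₁ 1 + (b : ℂ) * ω₂ 1 = 1
      simp [e1, e2, hab']
    · exact add_nonneg (mul_nonneg (by exact_mod_cast ha) (h₁.1.2 x))
        (mul_nonneg (by exact_mod_cast hb) (h₂.1.2 x))
    · change (a : ℂ) * ω₁ _ + (b : ℂ) * ω₂ _ = _
      rw [h₁.2, h₂.2, ← add_mul, hab', one_mul]
    · rfl
  have hext (ω : Unitization ℂ A →L[ℂ] ℂ) (hω : ⇑ω ∈ S'.extremePoints ℝ) :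
      IsExtremeState ω ∧ ∀ d, ω (starMap i d) = τ d := by
    rw [mem_extremePoints] at hω
    obtain ⟨⟨ω₀, hω₀, he⟩, hω⟩ := hω
    obtain rfl : ω₀ = StrongDual.toWeakDual ω := DFunLike.coe_injective he
    refine ⟨⟨hω₀.1, fun ω₁ ω₂ t h₁ h₂ ht0 ht1 heq => ?_⟩, hω₀.2⟩
    have hd (d) : τ d = t * ω₁ (starMap i d) + (1 - t) * ω₂ (starMap i d) := by
      rw [← hω₀.2 d]
      exact congrArg (fun f => f (starMap i d)) heq
    have := hω ω₁ ⟨StrongDual.toWeakDual ω₁, ⟨h₁, fun d => ?_⟩, rfl⟩ ω₂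
      ⟨StrongDual.toWeakDual ω₂, ⟨h₂, fun d => ?_⟩, rfl⟩ ⟨t, 1 - t, ht0, by linarith, by ring, ?_⟩
    · exact ⟨DFunLike.coe_injective this.1, DFunLike.coe_injective this.2⟩
    · exact IsUnitalState.eq_of_convexCombination _ τ h₁ h₂ ht0 ht1 hd d
    · refine IsUnitalState.eq_of_convexCombination _ τ (t := 1 - t) h₂ h₁ (by linarith)
        (by linarith) (fun d => ?_) d
      rw [hd]
      push_cast
      simp [add_comm]
    · funext b
      rw [heq]
      simp
  have hsub : (S'.extremePoints ℝ).Subsingleton := by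
    intro f₁ h₁ f₂ h₂
    obtain ⟨ω₁, -, rfl⟩ := h₁.1
    obtain ⟨ω₂, -, rfl⟩ := h₂.1
    have e₁ := hext (WeakDual.toStrongDual ω₁) h₁
    have e₂ := hext (WeakDual.toStrongDual ω₂) h₂
    exact congrArg (fun f : Unitization ℂ A →L[ℂ] ℂ => ⇑f)
      (hi.extremeState_unique τ e₁.1 e₂.1 e₁.2 e₂.2)
  have hKM := closure_convexHull_extremePoints hcomp' hconv
  have hSs : S'.Subsingleton := by
    rw [← hKM]
    obtain h0 | ⟨x, hx⟩ := hsub.eq_empty_or_singleton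
    · rw [h0]; simp
    · rw [hx]; simp
  exact DFunLike.coe_injective <|
    hSs ⟨StrongDual.toWeakDual ω, ⟨hω, h⟩, rfl⟩ ⟨StrongDual.toWeakDual ω', ⟨hω', h'⟩, rfl⟩

lemma exists_linear_le_sublinear {E : Type*} [AddCommGroup E] [Module ℝ E] (N : E → ℝ)
    (N_hom : ∀ c : ℝ, 0 < c → ∀ x, N (c • x) = c * N x) (N_add : ∀ x y, N (x + y) ≤ N x + N y)
    (x : E) : ∃ g : E →ₗ[ℝ] ℝ, g x = N x ∧ ∀ y, g y ≤ N y := by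
  have N_0 : N 0 = 0 := by
    have := N_hom 2 (by norm_num) 0
    rw [smul_zero] at this
    linarith
  have H (c : ℝ) (hc : c • x = 0) : (RingHom.id ℝ) c • N x = 0 := by
    obtain rfl | rfl := smul_eq_zero.mp hc
    · simp
    · simp [N_0]
  obtain ⟨g, hg, hle⟩ := exists_extension_of_le_sublinear
    (LinearPMap.mkSpanSingleton' x (N x) H) N N_hom N_add fun ⟨y, hy⟩ => by
      obtain ⟨c, rfl⟩ := Submodule.mem_span_singleton.mp hy
      rw [LinearPMap.mkSpanSingleton'_apply]
      change c * N x ≤ N (c • x)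
      obtain hc | rfl | hc := lt_trichotomy 0 c
      · rw [N_hom c hc]
      · simp [N_0]
      · have h1 := N_add x (-x)
        rw [add_neg_cancel, N_0] at h1
        have h2 := N_hom (-c) (neg_pos.mpr hc) (-x)
        rw [smul_neg, neg_smul, neg_neg] at h2
        rw [h2]
        nlinarith
  refine ⟨g, ?_, hle⟩
  have := hg ⟨x, Submodule.mem_span_singleton_self x⟩
  exact this.trans (LinearPMap.mkSpanSingleton'_apply_self _ _ _ _)

section Domination

open ComplexStarModule

variable {D B : Type*} [CommCStarAlgebra D] [CStarAlgebra B] [PartialOrder B] [StarOrderedRing B]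
  {j : D →⋆ₐ[ℂ] B} (τ : WeakDual.characterSpace ℂ D)

include τ in
lemma re_character_nonneg (hj : Function.Injective j) {c : D} (hc : 0 ≤ j c) :
    0 ≤ (τ c).re := by
  have hiso : ∀ d, ‖j d‖ = ‖d‖ := NonUnitalStarAlgHom.norm_map j hj
  have h1 : j c ≤ algebraMap ℝ B ‖c‖ := by
    rw [← hiso]
    exact IsSelfAdjoint.le_algebraMap_norm_self (IsSelfAdjoint.of_nonneg hc)
  have h2 : ‖algebraMap ℝ B ‖c‖ - j c‖ ≤ ‖c‖ := by
    rw [CStarAlgebra.norm_le_iff_le_algebraMap _ (norm_nonneg _) (sub_nonneg.mpr h1)]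
    exact sub_le_self _ hc
  have h3 : algebraMap ℝ B ‖c‖ - j c = j (algebraMap ℂ D ‖c‖ - c) := by
    rw [map_sub, AlgHomClass.commutes, IsScalarTower.algebraMap_apply ℝ ℂ B]
    rfl
  rw [h3, hiso] at h2
  have h4 : ‖τ (algebraMap ℂ D ‖c‖ - c)‖ ≤ ‖c‖ :=
    (((isExtremeState_of_character τ).1).norm_apply_le _).trans h2
  rw [map_sub, AlgHomClass.commutes] at h4
  have h5 := (Complex.re_le_norm _).trans h4
  simp at h5
  exact h5

variable (j) in
/-- The infimum of the values of a character on the elements dominating the real part of `b`. -/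
def upperValue (b : B) : ℝ :=
  sInf ((fun d => (τ d).re) '' {d | IsSelfAdjoint d ∧ (ℜ b : B) ≤ j d})

omit [PartialOrder B] [StarOrderedRing B] in
lemma map_ofReal_eq_algebraMap (r : ℝ) : j (algebraMap ℂ D r) = algebraMap ℝ B r := by
  rw [AlgHomClass.commutes, IsScalarTower.algebraMap_apply ℝ ℂ B]
  rfl

lemma dominating_nonempty (b : B) : {d | IsSelfAdjoint d ∧ (ℜ b : B) ≤ j d}.Nonempty := by
  refine ⟨algebraMap ℂ D (‖(ℜ b : B)‖ : ℝ), ?_, ?_⟩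
  · rw [isSelfAdjoint_iff, ← algebraMap_star_comm]
    simp
  · rw [map_ofReal_eq_algebraMap]
    exact IsSelfAdjoint.le_algebraMap_norm_self (ℜ b).2

lemma bddBelow_dominating (hj : Function.Injective j) (b : B) :
    BddBelow ((fun d => (τ d).re) '' {d | IsSelfAdjoint d ∧ (ℜ b : B) ≤ j d}) := by
  refine ⟨-‖(ℜ b : B)‖, ?_⟩
  rintro _ ⟨d, ⟨-, hd⟩, rfl⟩
  have h := re_character_nonneg τ hj (c := d + algebraMap ℂ D (‖(ℜ b : B)‖ : ℝ)) <| by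
    rw [map_add, map_ofReal_eq_algebraMap, ← sub_neg_eq_add, sub_nonneg]
    exact (IsSelfAdjoint.neg_algebraMap_norm_le_self (ℜ b).2).trans hd
  rw [map_add, AlgHomClass.commutes] at h
  simp at h
  linarith

lemma upperValue_le (hj : Function.Injective j) {b : B} {d : D} (hd : IsSelfAdjoint d)
    (h : (ℜ b : B) ≤ j d) : upperValue j τ b ≤ (τ d).re :=
  csInf_le (bddBelow_dominating τ hj b) ⟨d, ⟨hd, h⟩, rfl⟩

lemma exists_lt_upperValue_add (b : B) {ε : ℝ} (hε : 0 < ε) :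
    ∃ d, IsSelfAdjoint d ∧ (ℜ b : B) ≤ j d ∧ (τ d).re < upperValue j τ b + ε := by
  obtain ⟨_, ⟨d, hd, rfl⟩, h⟩ := exists_lt_of_csInf_lt
    ((dominating_nonempty b).image fun d => (τ d).re)
    (lt_add_of_pos_right (upperValue j τ b) hε)
  exact ⟨d, hd.1, hd.2, h⟩

lemma upperValue_add_le (hj : Function.Injective j) (x y : B) :
    upperValue j τ (x + y) ≤ upperValue j τ x + upperValue j τ y := by
  refine le_of_forall_pos_le_add fun ε hε => ?_
  obtain ⟨d, hd, hxd, hd'⟩ := exists_lt_upperValue_add (j := j) τ x (half_pos hε)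
  obtain ⟨e, he, hye, he'⟩ := exists_lt_upperValue_add (j := j) τ y (half_pos hε)
  have := upperValue_le τ hj (b := x + y) (hd.add he) (by
    rw [map_add, map_add]
    exact add_le_add hxd hye)
  rw [map_add, Complex.add_re] at this
  linarith

lemma upperValue_smul (hj : Function.Injective j) {c : ℝ} (hc : 0 < c) (x : B) :
    upperValue j τ (c • x) = c * upperValue j τ x := by
  have key {c : ℝ} (hc : 0 < c) (x : B) : upperValue j τ (c • x) ≤ c * upperValue j τ x := by
    refine le_of_forall_pos_le_add fun ε hε => ?_
    obtain ⟨d, hd, hxd, hd'⟩ := exists_lt_upperValue_add (j := j) τ x (div_pos hε hc)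
    have hmap (e : D) : j (c • e) = c • j e := by
      rw [← Complex.coe_smul, ← Complex.coe_smul, map_smul]
    have := upperValue_le τ hj (b := c • x) (d := c • d) ((IsSelfAdjoint.all c).smul hd) (by
      rw [map_smul, hmap]
      exact smul_le_smul_of_nonneg_left hxd hc.le)
    rw [← Complex.coe_smul c d, map_smul, smul_eq_mul, Complex.re_ofReal_mul] at this
    have h2 := mul_lt_mul_of_pos_left hd' hc
    rw [mul_add, mul_div_cancel₀ _ hc.ne'] at h2
    linarith
  refine le_antisymm (key hc x) ?_
  have := key (inv_pos.mpr hc) (c • x)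
  rw [smul_smul, inv_mul_cancel₀ hc.ne', one_smul] at this
  rwa [le_inv_mul_iff₀ hc] at this

lemma exists_isUnitalState_re_eq_upperValue (hj : Function.Injective j) (b : B) :
    ∃ ω : B →L[ℂ] ℂ, IsUnitalState ω ∧ (∀ d, ω (j d) = τ d) ∧ (ω b).re = upperValue j τ b := by
  obtain ⟨F, hFb, hF⟩ := exists_linear_le_sublinear (upperValue j τ)
    (fun c hc x => upperValue_smul τ hj hc x) (upperValue_add_le τ hj) b
  have hle {x : B} {d : D} (hd : IsSelfAdjoint d) (h : (ℜ x : B) ≤ j d) : F x ≤ (τ d).re :=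
    (hF x).trans (upperValue_le τ hj hd h)
  have hre (d : D) : (τ (ℜ d : D)).re = (τ d).re := by
    rw [map_realPart, Complex.coe_realPart, Complex.ofReal_re]
  have hjre (d : D) : (ℜ (j d) : B) = j (ℜ d : D) := (map_realPart j d).symm
  have hFj (d : D) : F (j d) = (τ d).re := by
    refine le_antisymm ?_ ?_
    · rw [← hre]
      exact hle (ℜ d).2 (hjre d).le
    · have := hle (x := j (-d)) (ℜ (-d)).2 (hjre _).le
      rw [hre] at this
      simpa using this
  have hnonpos {x : B} (h : (ℜ x : B) ≤ 0) : F x ≤ 0 := by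
    have := hle (x := x) (IsSelfAdjoint.zero D) (by rwa [map_zero])
    simpa using this
  let ω₀ : B →ₗ[ℂ] ℂ := Module.Dual.extendRCLike F
  have hω₀ (x) : ω₀ x = F x - Complex.I * F (Complex.I • x) := rfl
  have hj₀ (d : D) : ω₀ (j d) = τ d := by
    rw [hω₀, ← map_smul, hFj, hFj, map_smul]
    apply Complex.ext <;> simp
  have h1 : ω₀ 1 = 1 := by
    rw [← map_one j, hj₀, map_one]
  have hp (x : B) : 0 ≤ ω₀ (star x * x) := by
    have hs : IsSelfAdjoint (star x * x) := IsSelfAdjoint.star_mul_self x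
    have hre0 : 0 ≤ F (star x * x) := by
      have := hnonpos (x := -(star x * x)) (by
        rw [hs.neg.coe_realPart]
        exact neg_nonpos.mpr (star_mul_self_nonneg x))
      rw [map_neg] at this
      linarith
    have him : F (Complex.I • (star x * x)) = 0 := by
      have h0 : (ℜ (Complex.I • (star x * x)) : B) = 0 := by
        rw [realPart_I_smul, hs.imaginaryPart]
        simp
      refine le_antisymm (hnonpos h0.le) ?_
      have := hnonpos (x := -(Complex.I • (star x * x))) (by
        rw [map_neg, NegMemClass.coe_neg, h0, neg_zero])
      rw [map_neg] at this
      linarith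
    rw [hω₀, him]
    simpa using hre0
  refine ⟨ω₀.mkContinuous 1 fun b => by
    simpa using norm_apply_le_of_positive ω₀ h1 hp b, ⟨h1, hp⟩, hj₀, ?_⟩
  rw [← hFb, LinearMap.mkContinuous_apply, hω₀]
  simp

/-- If a character has only one state extension, then every self-adjoint element is squeezed
between elements of the commutative subalgebra on which the character is nearly constant. -/
lemma exists_squeeze (hj : Function.Injective j)
    (hu : ∀ ω ω' : B →L[ℂ] ℂ, IsUnitalState ω → IsUnitalState ω' → (∀ d, ω (j d) = τ d) →
      (∀ d, ω' (j d) = τ d) → ω = ω') {b : B} (hb : IsSelfAdjoint b) {ε : ℝ} (hε : 0 < ε) :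
    ∃ (r : ℝ) (d d' : D), IsSelfAdjoint d ∧ IsSelfAdjoint d' ∧ j d' ≤ b ∧ b ≤ j d ∧
      (τ d).re < r + ε ∧ r - ε < (τ d').re := by
  obtain ⟨ω, hω, hωj, hωb⟩ := exists_isUnitalState_re_eq_upperValue τ hj b
  obtain ⟨ω', hω', hωj', hωb'⟩ := exists_isUnitalState_re_eq_upperValue τ hj (-b)
  obtain rfl := hu ω ω' hω hω' hωj hωj'
  obtain ⟨d, hd, hbd, hdr⟩ := exists_lt_upperValue_add (j := j) τ b hε
  obtain ⟨e, he, hbe, her⟩ := exists_lt_upperValue_add (j := j) τ (-b) hε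
  rw [hb.coe_realPart] at hbd
  rw [hb.neg.coe_realPart] at hbe
  rw [map_neg, Complex.neg_re] at hωb'
  refine ⟨(ω b).re, d, -e, hd, he.neg, ?_, hbd, by rwa [hωb], ?_⟩
  · rw [map_neg]
    exact neg_le.mp hbe
  · rw [map_neg, Complex.neg_re]
    linarith

end Domination

section Gelfand

open WeakDual

variable {D : Type*} [CommCStarAlgebra D]

lemma eq_of_forall_character_eq {d e : D} (h : ∀ τ : characterSpace ℂ D, τ d = τ e) : d = e :=
  (gelfandStarTransform D).injective (ContinuousMap.ext h)

/-- The element of a commutative C⋆-algebra with a given real Gelfand transform. -/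
def ofRealGelfand (f : C(characterSpace ℂ D, ℝ)) : D :=
  (gelfandStarTransform D).symm ⟨fun τ => (f τ : ℂ), by fun_prop⟩

lemma character_ofRealGelfand (f : C(characterSpace ℂ D, ℝ)) (τ : characterSpace ℂ D) :
    τ (ofRealGelfand f) = f τ :=
  congrArg (fun g => g τ) ((gelfandStarTransform D).apply_symm_apply ⟨fun τ => (f τ : ℂ), _⟩)

lemma isSelfAdjoint_ofRealGelfand (f : C(characterSpace ℂ D, ℝ)) :
    IsSelfAdjoint (ofRealGelfand f) :=
  eq_of_forall_character_eq fun τ => by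
    rw [map_star, character_ofRealGelfand]
    simp

lemma IsSelfAdjoint.character_eq_re {d : D} (hd : IsSelfAdjoint d) (τ : characterSpace ℂ D) :
    τ d = ((τ d).re : ℂ) :=
  (Complex.conj_eq_iff_re.mp (hd.map τ)).symm

lemma continuous_re_character (d : D) : Continuous fun τ : characterSpace ℂ D => (τ d).re :=
  Complex.continuous_re.comp (gelfandStarTransform D d).continuous

lemma map_nonneg_of_character_nonneg {B : Type*} [CStarAlgebra B] [PartialOrder B]
    [StarOrderedRing B] (j : D →⋆ₐ[ℂ] B) {d : D} (hd : IsSelfAdjoint d)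
    (h : ∀ τ : characterSpace ℂ D, 0 ≤ (τ d).re) : 0 ≤ j d := by
  set s : D := ofRealGelfand ⟨fun τ => √(τ d).re, (continuous_re_character d).sqrt⟩ with hs
  have : d = star s * s := eq_of_forall_character_eq fun τ => by
    rw [(isSelfAdjoint_ofRealGelfand _).star_eq, map_mul, character_ofRealGelfand,
      hd.character_eq_re]
    simp only [ContinuousMap.coe_mk]
    rw [← Complex.ofReal_mul, Real.mul_self_sqrt (h τ)]
  rw [this, map_mul, map_star]
  exact star_mul_self_nonneg _

end Gelfand

section Partition

open WeakDual

lemma norm_le_of_neg_algebraMap_le {B : Type*} [CStarAlgebra B] [PartialOrder B]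
    [StarOrderedRing B] {x : B} {r : ℝ} (hr : 0 ≤ r) (h₁ : -algebraMap ℝ B r ≤ x)
    (h₂ : x ≤ algebraMap ℝ B r) : ‖x‖ ≤ 3 * r := by
  have h3 : ‖x + algebraMap ℝ B r‖ ≤ 2 * r := by
    refine (CStarAlgebra.mem_Icc_algebraMap_iff_norm_le (by linarith)).mp ⟨?_, ?_⟩ |>.2
    · rwa [← sub_neg_eq_add, sub_nonneg]
    · rw [two_mul, map_add]
      exact add_le_add_left h₂ _
  have h4 : ‖algebraMap ℝ B r‖ ≤ r :=
    ((CStarAlgebra.mem_Icc_algebraMap_iff_norm_le hr).mp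
      ⟨algebraMap_nonneg B hr, le_rfl⟩).2
  calc ‖x‖ = ‖(x + algebraMap ℝ B r) - algebraMap ℝ B r‖ := by rw [add_sub_cancel_right]
    _ ≤ 2 * r + r := (norm_sub_le _ _).trans (add_le_add h3 h4)
    _ = 3 * r := by ring

variable {D B : Type*} [CommCStarAlgebra D] [CStarAlgebra B] [PartialOrder B] [StarOrderedRing B]
  {j : D →⋆ₐ[ℂ] B}

lemma conjugate_le_of_character_le {g d : D} (hg : IsSelfAdjoint g) (hd : IsSelfAdjoint d) {b : B}
    (hb : b ≤ j d) {s : ℝ} (h : ∀ τ : characterSpace ℂ D, τ g ≠ 0 → (τ d).re ≤ s) :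
    j g * b * j g ≤ j ((s : ℂ) • (g * g)) := by
  refine ((hg.map j).conjugate_le_conjugate hb).trans ?_
  rw [← map_mul, ← map_mul, ← sub_nonneg, ← map_sub]
  refine map_nonneg_of_character_nonneg j ?_ fun τ => ?_
  · exact (IsSelfAdjoint.smul (by simp [isSelfAdjoint_iff]) (hg.mul hg)).sub ((hg.mul hd).mul hg)
  · simp only [map_sub, map_mul, map_smul, smul_eq_mul]
    rw [hg.character_eq_re, hd.character_eq_re]
    norm_cast
    by_cases h0 : τ g = 0
    · simp [h0]
    · nlinarith [h τ h0, mul_self_nonneg (τ g).re]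

/-- If every character of a commutative subalgebra extends uniquely to a state, then finitely many
elements are approximately averaged into the subalgebra by a partition of unity. -/
lemma exists_partition_averaging (hj : Function.Injective j)
    (hu : ∀ (τ : characterSpace ℂ D) (ω ω' : B →L[ℂ] ℂ), IsUnitalState ω → IsUnitalState ω' →
      (∀ d, ω (j d) = τ d) → (∀ d, ω' (j d) = τ d) → ω = ω')
    {ι : Type*} [Finite ι] {b : ι → B} (hb : ∀ i, IsSelfAdjoint (b i)) {ε : ℝ} (hε : 0 < ε) :
    ∃ (n : ℕ) (g : Fin n → D) (e : ι → D), (∀ k, IsSelfAdjoint (g k)) ∧ ∑ k, g k * g k = 1 ∧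
      ∀ i, ‖∑ k, j (g k) * b i * j (g k) - j (e i)‖ ≤ 3 * ε := by
  choose r d d' hd hd' hdb hbd hr hr' using fun τ i => exists_squeeze τ hj (hu τ) (hb i) hε
  let U (τ : characterSpace ℂ D) : Set (characterSpace ℂ D) :=
    ⋂ i, {σ | (σ (d τ i)).re < r τ i + ε} ∩ {σ | r τ i - ε < (σ (d' τ i)).re}
  have hU (τ) : IsOpen (U τ) := isOpen_iInter_of_finite fun i =>
    (isOpen_lt (continuous_re_character _) continuous_const).inter
      (isOpen_lt continuous_const (continuous_re_character _))
  obtain ⟨t, ht⟩ := isCompact_univ.elim_finite_subcover U hU fun τ _ =>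
    Set.mem_iUnion.mpr ⟨τ, Set.mem_iInter.mpr fun i => ⟨hr τ i, hr' τ i⟩⟩
  let p : Fin t.card → characterSpace ℂ D := fun k => t.equivFin.symm k
  obtain ⟨f, hfs, hf1, hf0, -⟩ := exists_continuous_sum_one_of_isOpen_isCompact
    (s := fun k => U (p k)) (fun k => hU (p k)) isCompact_univ fun σ hσ => by
      obtain ⟨τ, hτ, hσ⟩ := Set.mem_iUnion₂.mp (ht hσ)
      refine Set.mem_iUnion.mpr ⟨t.equivFin ⟨τ, hτ⟩, ?_⟩
      simpa [p] using hσ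
  let g (k : Fin t.card) : D := ofRealGelfand ⟨fun σ => √(f k σ), (f k).continuous.sqrt⟩
  have hg (k) : IsSelfAdjoint (g k) := isSelfAdjoint_ofRealGelfand _
  have hgσ (k) (σ : characterSpace ℂ D) : σ (g k) = (√(f k σ) : ℝ) := character_ofRealGelfand _ σ
  have hsum : ∑ k, g k * g k = 1 := eq_of_forall_character_eq fun σ => by
    rw [map_sum, map_one]
    simp only [map_mul, hgσ, ← Complex.ofReal_mul, Real.mul_self_sqrt (hf0 _ _).1]
    rw [← Complex.ofReal_sum, ← Complex.ofReal_one]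
    congr 1
    simpa using hf1 (Set.mem_univ σ)
  have hgU (k) (σ : characterSpace ℂ D) (h : σ (g k) ≠ 0) : σ ∈ U (p k) := by
    refine hfs k (subset_tsupport _ fun h0 => h ?_)
    rw [hgσ, h0]
    simp
  have halg : j (∑ k, (ε : ℂ) • (g k * g k)) = algebraMap ℝ B ε := by
    rw [← Finset.smul_sum, hsum, ← Algebra.algebraMap_eq_smul_one, map_ofReal_eq_algebraMap]
  refine ⟨t.card, g, fun i => ∑ k, (r (p k) i : ℂ) • (g k * g k), hg, hsum, fun i => ?_⟩
  refine norm_le_of_neg_algebraMap_le hε.le ?_ ?_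
  · rw [neg_le_sub_iff_le_add, ← halg, ← sub_le_iff_le_add, ← map_sub, ← Finset.sum_sub_distrib,
      map_sum]
    refine Finset.sum_le_sum fun k _ => ?_
    have := conjugate_le_of_character_le (j := j) (hg k) (hd' (p k) i).neg (b := -b i)
      (s := -(r (p k) i - ε)) (by rw [map_neg]; exact neg_le_neg (hdb (p k) i)) fun σ hσ => by
        have := (Set.mem_iInter.mp (hgU k σ hσ) i).2
        rw [map_neg, Complex.neg_re]
        exact neg_le_neg (le_of_lt this)
    rw [mul_neg, neg_mul, Complex.ofReal_neg, neg_smul, map_neg, neg_le_neg_iff] at this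
    rwa [← sub_smul, ← Complex.ofReal_sub]
  · rw [sub_le_iff_le_add, ← halg, ← map_add, ← Finset.sum_add_distrib, map_sum]
    refine Finset.sum_le_sum fun k _ => ?_
    have := conjugate_le_of_character_le (j := j) (hg k) (hd (p k) i)
      (s := ε + r (p k) i) (hbd (p k) i) fun σ hσ => by
        have := (Set.mem_iInter.mp (hgU k σ hσ) i).1
        rw [add_comm]
        exact le_of_lt this
    rwa [← add_smul, ← Complex.ofReal_add]

end Partition

section Averaging

open ComplexStarModule

lemma norm_sum_conjugate_le {B : Type*} [CStarAlgebra B] {n : ℕ} {G : Fin n → B}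
    (hG : ∀ k, IsSelfAdjoint (G k)) (hsum : ∑ k, G k * G k = 1) (z : B) :
    ‖∑ k, G k * z * G k‖ ≤ 6 * ‖z‖ := by
  let _ := CStarAlgebra.spectralOrder B
  have := CStarAlgebra.spectralOrderedRing B
  have hscal (r : ℝ) : ∑ k, G k * algebraMap ℝ B r * G k = algebraMap ℝ B r := by
    simp_rw [← Algebra.commutes, mul_assoc]
    rw [← Finset.mul_sum, hsum, mul_one]
  have key {z : B} (hz : IsSelfAdjoint z) : ‖∑ k, G k * z * G k‖ ≤ 3 * ‖z‖ := by
    refine norm_le_of_neg_algebraMap_le (norm_nonneg z) ?_ ?_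
    · rw [← map_neg, ← hscal]
      refine Finset.sum_le_sum fun k _ => (hG k).conjugate_le_conjugate ?_
      rw [map_neg]
      exact hz.neg_algebraMap_norm_le_self
    · conv_rhs => rw [← hscal]
      exact Finset.sum_le_sum fun k _ => (hG k).conjugate_le_conjugate hz.le_algebraMap_norm_self
  have hsplit : ∑ k, G k * z * G k =
      ∑ k, G k * (ℜ z : B) * G k + Complex.I • ∑ k, G k * (ℑ z : B) * G k := by
    rw [Finset.smul_sum, ← Finset.sum_add_distrib]
    refine Finset.sum_congr rfl fun k _ => ?_
    conv_lhs => rw [← realPart_add_I_smul_imaginaryPart z]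
    rw [mul_add, add_mul, mul_smul_comm, smul_mul_assoc]
  have hre : ‖(ℜ z : B)‖ ≤ ‖z‖ := realPart.norm_le z
  have him : ‖(ℑ z : B)‖ ≤ ‖z‖ := imaginaryPart.norm_le z
  calc ‖∑ k, G k * z * G k‖ ≤ 3 * ‖(ℜ z : B)‖ + 3 * ‖(ℑ z : B)‖ := by
        rw [hsplit]
        refine (norm_add_le _ _).trans (add_le_add (key (ℜ z).2) ?_)
        rw [norm_smul, Complex.norm_I, one_mul]
        exact key (ℑ z).2
    _ ≤ 6 * ‖z‖ := by linarith

lemma CStarCompletion.exists_selfAdjoint_sum {A₁ A₂ T : Type*} [NonUnitalCStarAlgebra A₁]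
    [NonUnitalCStarAlgebra A₂] [NonUnitalCStarAlgebra T] (K : CStarCompletion A₁ A₂ T) {y : T}
    (hy : y ∈ Submodule.span ℂ {x : T | ∃ a b, x = K.ι₁ a * K.ι₂ b}) :
    ∃ (n : ℕ) (a : Fin n → A₁) (b : Fin n → A₂), (∀ k, IsSelfAdjoint (a k)) ∧
      y = ∑ k, K.ι₁ (a k) * K.ι₂ (b k) := by
  have hle : Submodule.span ℂ {x : T | ∃ a b, x = K.ι₁ a * K.ι₂ b} ≤
      Submodule.span ℂ {x : T | ∃ a b, IsSelfAdjoint a ∧ x = K.ι₁ a * K.ι₂ b} := by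
    refine Submodule.span_le.mpr ?_
    rintro _ ⟨a, b, rfl⟩
    rw [← realPart_add_I_smul_imaginaryPart a, map_add, add_mul, map_smul, smul_mul_assoc]
    exact add_mem (Submodule.subset_span ⟨_, b, (ℜ a).2, rfl⟩)
      (Submodule.smul_mem _ _ (Submodule.subset_span ⟨_, b, (ℑ a).2, rfl⟩))
  obtain ⟨n, f, g, rfl⟩ := Submodule.mem_span_set'.mp (hle hy)
  choose a b ha hg using fun k => (g k).2
  refine ⟨n, a, fun k => f k • b k, ha, Finset.sum_congr rfl fun k _ => ?_⟩
  rw [hg, map_smul, mul_smul_comm]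

end Averaging

/-- Averaging over a partition of unity in the commutative subalgebra moves elements of the algebra
close to the subalgebra. -/
lemma EmbeddingHasExtensionProperty.exists_averaging {A C : Type*} [NonUnitalCStarAlgebra A]
    [NonUnitalCommCStarAlgebra C] {i : C →⋆ₙₐ[ℂ] A} (hi : EmbeddingHasExtensionProperty i)
    (hinj : Function.Injective i) {ι : Type*} [Finite ι] {a : ι → A}
    (ha : ∀ k, IsSelfAdjoint (a k)) {ε : ℝ} (hε : 0 < ε) :
    ∃ (n : ℕ) (g : Fin n → Unitization ℂ C) (c : ι → C), (∀ k, IsSelfAdjoint (g k)) ∧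
      ∑ k, g k * g k = 1 ∧
      ∀ l, ‖∑ k, starMap i (g k) * (a l : Unitization ℂ A) * starMap i (g k) -
        (i (c l) : Unitization ℂ A)‖ ≤ 6 * ε := by
  let _ := CStarAlgebra.spectralOrder (Unitization ℂ A)
  have := CStarAlgebra.spectralOrderedRing (Unitization ℂ A)
  obtain ⟨n, g, e, hg, hsum, he⟩ := exists_partition_averaging (j := starMap i)
    (starMap_injective hinj) (fun τ ω ω' hω hω' => hi.state_unique τ hω hω')
    (b := fun l => (a l : Unitization ℂ A)) (fun l => (ha l).inr ℂ) hε
  refine ⟨n, g, fun l => (e l).snd, hg, hsum, fun l => ?_⟩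
  set y := ∑ k, starMap i (g k) * (a l : Unitization ℂ A) * starMap i (g k) with hy
  have hej : starMap i (e l) =
      algebraMap ℂ (Unitization ℂ A) (e l).fst + (i (e l).snd : Unitization ℂ A) := by
    conv_lhs => rw [← inl_fst_add_inr_snd_eq (e l)]
    rw [map_add, starMap_inr, starMap_inl]
  have hy0 : y.fst = 0 := by
    change fstHom ℂ A y = 0
    rw [hy, map_sum]
    exact Finset.sum_eq_zero fun k _ => by simp
  have hfst : ‖(e l).fst‖ ≤ 3 * ε := by
    have h1 : ‖(y - starMap i (e l)).fst‖ ≤ 3 * ε := by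
      refine le_trans ?_ (he l)
      rw [Unitization.norm_def, Unitization.splitMul_apply]
      exact le_max_left _ _
    rw [show (y - starMap i (e l)).fst = y.fst - (starMap i (e l)).fst from rfl, hej, hy0] at h1
    simpa [algebraMap_eq_inl] using h1
  have hsub : y - (i (e l).snd : Unitization ℂ A) =
      (y - starMap i (e l)) + algebraMap ℂ (Unitization ℂ A) (e l).fst := by
    rw [hej]
    abel
  rw [hsub]
  calc _ ≤ 3 * ε + 3 * ε := (norm_add_le _ _).trans (add_le_add (he l) (by rwa [norm_algebraMap']))
    _ = 6 * ε := by ring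

/-- An element commuting with a commutative subalgebra having the extension property is a limit of
tensors over that subalgebra. -/
theorem CStarCompletion.mem_closure_of_commute {A₁ A₂ C T : Type*} [NonUnitalCStarAlgebra A₁]
    [NonUnitalCStarAlgebra A₂] [NonUnitalCommCStarAlgebra C] [NonUnitalCStarAlgebra T]
    {i : C →⋆ₙₐ[ℂ] A₁} (hi : EmbeddingHasExtensionProperty i) (hinj : Function.Injective i)
    (K : CStarCompletion A₁ A₂ T) {x : T} (hx : ∀ c, x * K.ι₁ (i c) = K.ι₁ (i c) * x) :
    x ∈ closure (Submodule.span ℂ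
      {x : T | ∃ (c : C) (b : A₂), x = K.ι₁ (i c) * K.ι₂ b} : Set T) := by
  refine Metric.mem_closure_iff.mpr fun δ hδ => ?_
  obtain ⟨y, hy, hxy⟩ := Metric.mem_closure_iff.mp (K.dense_span x) (δ / 12) (by positivity)
  obtain ⟨m, a, b, ha, rfl⟩ := K.exists_selfAdjoint_sum hy
  set M := ∑ l, ‖b l‖ with hM
  have hM0 : 0 ≤ M := Finset.sum_nonneg fun l _ => norm_nonneg _
  obtain ⟨n, g, c, hg, hsum, hgc⟩ :=
    hi.exists_averaging hinj ha (ε := δ / (12 * (1 + M))) (by positivity)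
  refine ⟨∑ l, K.ι₁ (i (c l)) * K.ι₂ (b l),
    sum_mem fun l _ => Submodule.subset_span ⟨c l, b l, rfl⟩, ?_⟩
  let F := starMap K.ι₁
  let G (k : Fin n) : Unitization ℂ T := F (starMap i (g k))
  have hGsa (k) : IsSelfAdjoint (G k) := ((hg k).map (starMap i)).map F
  have hGsum : ∑ k, G k * G k = 1 := by
    simp only [G, ← map_mul, ← map_sum, hsum, map_one]
  have hcomm (k) {z : T} (hz : ∀ c, z * K.ι₁ (i c) = K.ι₁ (i c) * z) :
      (z : Unitization ℂ T) * G k = G k * z := by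
    have hGk : G k = algebraMap ℂ (Unitization ℂ T) (g k).fst +
        (K.ι₁ (i (g k).snd) : Unitization ℂ T) := by
      change F (starMap i (g k)) = _
      conv_lhs => rw [← inl_fst_add_inr_snd_eq (g k)]
      rw [map_add, map_add, starMap_inr, starMap_inr, starMap_inl, AlgHomClass.commutes]
    rw [hGk, mul_add, add_mul, Algebra.commutes, ← inr_mul, ← inr_mul, hz]
  have havg : ∑ k, G k * (x : Unitization ℂ T) * G k = x := by
    simp_rw [← hcomm _ hx, mul_assoc]
    rw [← Finset.mul_sum, hGsum, mul_one]
  have hterm (l) : ∑ k, G k * ((K.ι₁ (a l) * K.ι₂ (b l) : T) : Unitization ℂ T) * G k =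
      F (∑ k, starMap i (g k) * (a l : Unitization ℂ A₁) * starMap i (g k)) * (K.ι₂ (b l) : T) := by
    rw [map_sum, Finset.sum_mul]
    refine Finset.sum_congr rfl fun k _ => ?_
    rw [inr_mul, map_mul, map_mul, mul_assoc, mul_assoc, mul_assoc, mul_assoc,
      hcomm k fun c => (K.commutes (i c) (b l)).symm, starMap_inr]
  have hb (l) : ‖K.ι₂ (b l)‖ = ‖b l‖ := by
    simpa using K.isometry₂.dist_eq (b l) 0
  set y := ∑ l, K.ι₁ (a l) * K.ι₂ (b l) with hydef
  have hdiff : ((x - ∑ l, K.ι₁ (i (c l)) * K.ι₂ (b l) : T) : Unitization ℂ T) =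
      ∑ k, G k * ((x - y : T) : Unitization ℂ T) * G k +
      ∑ l, F (∑ k, starMap i (g k) * (a l : Unitization ℂ A₁) * starMap i (g k) -
        (i (c l) : Unitization ℂ A₁)) * (K.ι₂ (b l) : T) := by
    have hsumG : ∑ k, G k * (y : Unitization ℂ T) * G k =
        ∑ l, F (∑ k, starMap i (g k) * (a l : Unitization ℂ A₁) * starMap i (g k)) *
          (K.ι₂ (b l) : T) := by
      simp_rw [← hterm]
      rw [Finset.sum_comm]
      refine Finset.sum_congr rfl fun k _ => ?_
      rw [hydef, ← inrHom_apply ℂ, map_sum, Finset.mul_sum, Finset.sum_mul]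
      rfl
    have hsumc : ((∑ l, K.ι₁ (i (c l)) * K.ι₂ (b l) : T) : Unitization ℂ T) =
        ∑ l, F (i (c l) : Unitization ℂ A₁) * (K.ι₂ (b l) : T) := by
      rw [← inrHom_apply ℂ, map_sum]
      refine Finset.sum_congr rfl fun l _ => ?_
      rw [starMap_inr, ← inr_mul]
      rfl
    simp_rw [inr_sub, mul_sub, sub_mul, Finset.sum_sub_distrib, havg, map_sub, sub_mul,
      Finset.sum_sub_distrib]
    rw [hsumG, hsumc]
    abel
  rw [dist_eq_norm, ← norm_inr (𝕜 := ℂ), hdiff]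
  have h1 := norm_sum_conjugate_le hGsa hGsum ((x - y : T) : Unitization ℂ T)
  rw [norm_inr, ← dist_eq_norm] at h1
  have h2 : ‖∑ l, F (∑ k, starMap i (g k) * (a l : Unitization ℂ A₁) * starMap i (g k) -
      (i (c l) : Unitization ℂ A₁)) * (K.ι₂ (b l) : T)‖ ≤ δ / 2 := by
    calc _ ≤ ∑ l, 6 * (δ / (12 * (1 + M))) * ‖b l‖ := by
          refine norm_sum_le_of_le _ fun l _ => (norm_mul_le _ _).trans ?_
          rw [norm_inr, hb]
          gcongr
          exact (NonUnitalStarAlgHom.norm_apply_le F _).trans (hgc l)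
      _ = δ / 2 * (M / (1 + M)) := by
          rw [← Finset.mul_sum, ← hM]
          field_simp
          ring
      _ ≤ δ / 2 * 1 := by
          gcongr
          rw [div_le_one (by positivity)]
          linarith
      _ = δ / 2 := mul_one _
  calc _ ≤ 6 * dist x y + δ / 2 := (norm_add_le _ _).trans (add_le_add h1 h2)
    _ < δ := by linarith

/-- Theorem 2: if `C` is a masa of `A₁` with the extension property and
`A₂` is unital, then in any C*-completion `A₁ ⊗_β A₂` the relative commutant of
`C ⊗ 1` is `C ⊗ A₂`. -/
theorem stmt_3 {A₁ A₂ T : Type*}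
    [NonUnitalCStarAlgebra A₁] [CStarAlgebra A₂] [NonUnitalCStarAlgebra T]
    (C : NonUnitalStarSubalgebra ℂ A₁) (hmasa : IsMasa C)
    (hext : HasExtensionProperty C)
    (K : CStarCompletion A₁ A₂ T) :
    {x : T | ∀ c ∈ C, x * K.ι₁ c = K.ι₁ c * x} =
      closure (Submodule.span ℂ
        {x : T | ∃ c ∈ C, ∃ b : A₂, x = K.ι₁ c * K.ι₂ b} : Set T) := by
  have hclosed : IsClosed (C : Set A₁) := by
    have : (C : Set A₁) = ⋂ c ∈ C, {x | c * x = x * c} := by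
      ext x
      simp only [Set.mem_iInter, Set.mem_ofPred_eq, SetLike.mem_coe]
      exact ⟨fun hx c hc => hmasa.1 c hc x hx, hmasa.2 x⟩
    rw [this]
    exact isClosed_biInter fun c _ =>
      isClosed_eq (continuous_const_mul c) (continuous_mul_const c)
  apply subset_antisymm
  · intro x hx
    have : IsClosed (C : Set A₁) := hclosed
    let _ : NonUnitalCommCStarAlgebra C :=
      { (inferInstance : NonUnitalCStarAlgebra C) with
        mul_comm := fun a b => Subtype.ext (hmasa.1 a a.2 b b.2) }
    let i : C →⋆ₙₐ[ℂ] A₁ := NonUnitalStarSubalgebraClass.subtype C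
    have hi : EmbeddingHasExtensionProperty i :=
      ⟨hext.1, fun φ hφ => by
        obtain ⟨c, hc, h⟩ := hext.2 φ hφ
        exact ⟨⟨c, hc⟩, h⟩⟩
    have hmem := K.mem_closure_of_commute hi Subtype.val_injective fun c => hx c c.2
    refine closure_mono (Submodule.span_mono ?_) hmem
    rintro _ ⟨c, b, rfl⟩
    exact ⟨c, c.2, b, rfl⟩
  · refine closure_minimal ?_ ?_
    · intro x hx c hc
      induction hx using Submodule.span_induction with
      | mem x hx =>
        obtain ⟨d, hd, b, rfl⟩ := hx
        rw [mul_assoc, ← K.commutes, ← mul_assoc, ← mul_assoc, ← map_mul, ← map_mul,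
          hmasa.1 d hd c hc]
      | zero => rw [zero_mul, mul_zero]
      | add x y _ _ hx hy => rw [add_mul, mul_add, hx, hy]
      | smul r x _ hx => rw [smul_mul_assoc, mul_smul_comm, hx]
    · simp only [Set.ofPred_forall]
      exact isClosed_biInter fun c _ =>
        isClosed_eq (continuous_mul_const _) (continuous_const_mul _)
end
end

section
/- Let A be a non-unital C*-algebra with unitization Ã = A + ℂ·1, and let C be a masa of A with the extension property. Then C̃ = C + ℂ·1 is a masa of Ã with the extension property. -/
set_option maxHeartbeats 1000000
set_option synthInstance.maxHeartbeats 1000000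

open scoped ComplexOrder TensorProduct

noncomputable section

open Filter Topology

section PositiveFunctionals

variable {B : Type*} [NonUnitalCStarAlgebra B]

/-- The Cauchy-Schwarz inequality for positive functionals on a C*-algebra. -/
theorem norm_apply_star_mul_sq_le_s4 {f : B →L[ℂ] ℂ} (hf : ∀ a, 0 ≤ f (star a * a)) (a b : B) :
    ‖f (star a * b)‖ ^ 2 ≤ (f (star a * a)).re * (f (star b * b)).re := by
  let _ := CStarAlgebra.spectralOrder B
  let _ := CStarAlgebra.spectralOrderedRing B
  let F : B →ₚ[ℂ] ℂ := PositiveLinearMap.mk₀ f.toLinearMap fun x hx => by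
    obtain ⟨y, rfl⟩ := CStarAlgebra.nonneg_iff_eq_star_mul_self.mp hx
    exact hf y
  have h := norm_inner_le_norm (𝕜 := ℂ) (F.toPreGNS a) (F.toPreGNS b)
  have h2 : ‖f (star a * b)‖ ^ 2 ≤ (‖F.toPreGNS a‖ * ‖F.toPreGNS b‖) ^ 2 :=
    pow_le_pow_left₀ (norm_nonneg _) h 2
  have hF (c : B) : ‖F.toPreGNS c‖ ^ 2 = (f (star c * c)).re :=
    Real.sq_sqrt (Complex.le_def.mp (hf c)).1
  rwa [mul_pow, hF, hF] at h2

theorem re_apply_star_mul_self_le (f : B →L[ℂ] ℂ) (a : B) :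
    (f (star a * a)).re ≤ ‖f‖ * ‖a‖ ^ 2 := by
  calc (f (star a * a)).re ≤ ‖f (star a * a)‖ := Complex.re_le_norm _
    _ ≤ ‖f‖ * ‖star a * a‖ := f.le_opNorm _
    _ = ‖f‖ * ‖a‖ ^ 2 := by rw [CStarRing.norm_star_mul_self, sq]

theorem exists_selfAdjoint_approximateUnit (B : Type*) [NonUnitalCStarAlgebra B] :
    ∃ l : Filter B, l.IsApproximateUnit ∧ (∀ᶠ e in l, star e = e) ∧ ∀ᶠ e in l, ‖e‖ ≤ 1 := by
  let _ := CStarAlgebra.spectralOrder B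
  let _ := CStarAlgebra.spectralOrderedRing B
  have h := CStarAlgebra.increasingApproximateUnit B
  exact ⟨_, h.toIsApproximateUnit, h.eventually_star_eq, h.eventually_norm⟩

/-- A state converges to `1` along the squares of an approximate unit. -/
theorem IsState.tendsto_approximateUnit_sq {g : B →L[ℂ] ℂ} (hg : IsState g) {l : Filter B}
    (hl : l.IsApproximateUnit) (hstar : ∀ᶠ e in l, star e = e) (hnorm : ∀ᶠ e in l, ‖e‖ ≤ 1) :
    Tendsto (fun e => g (e * e)) l (𝓝 1) := by
  have hre : Tendsto (fun e => (g (e * e)).re) l (𝓝 1) := by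
    refine tendsto_order.2 ⟨fun r hr => ?_, fun r hr => ?_⟩
    · obtain ⟨b, hb1, hb⟩ : ∃ b : B, ‖b‖ < 1 ∧ max r 0 < ‖g b‖ ^ 2 := by
        have hs : √(max r 0) < ‖g‖ := by
          rw [hg.1, Real.sqrt_lt' one_pos, one_pow]
          exact max_lt hr one_pos
        obtain ⟨b, hb1, hb⟩ := g.exists_lt_apply_of_lt_opNorm hs
        exact ⟨b, hb1, (Real.sqrt_lt' ((Real.sqrt_nonneg _).trans_lt hb)).1 hb⟩
      have ht : Tendsto (fun e => ‖g (e * b)‖ ^ 2) l (𝓝 (‖g b‖ ^ 2)) :=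
        (((g.continuous.tendsto b).comp (hl.tendsto_mul_right b)).norm).pow 2
      filter_upwards [ht.eventually_const_lt hb, hstar] with e he hse
      have h1 := norm_apply_star_mul_sq_le_s4 hg.2 e b
      have h2 := re_apply_star_mul_self_le g b
      have h3 : 0 ≤ (g (star e * e)).re := (Complex.le_def.mp (hg.2 e)).1
      rw [hse] at h1 h3
      rw [hg.1, one_mul] at h2
      have h4 : ‖b‖ ^ 2 ≤ 1 := pow_le_one₀ (norm_nonneg _) hb1.le
      have h5 := mul_le_mul_of_nonneg_left (h2.trans h4) h3
      rw [mul_one] at h5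
      exact (le_max_left r 0).trans_lt (he.trans_le (h1.trans h5))
    · filter_upwards [hstar, hnorm] with e hse he
      have h2 := re_apply_star_mul_self_le g e
      rw [hse, hg.1, one_mul] at h2
      exact (h2.trans (pow_le_one₀ (norm_nonneg _) he)).trans_lt hr
  have h := (Complex.continuous_ofReal.tendsto 1).comp hre
  rw [Complex.ofReal_one] at h
  refine h.congr' ?_
  filter_upwards [hstar] with e hse
  have h3 := hg.2 e
  rw [hse] at h3
  exact Complex.ext rfl (Complex.le_def.mp h3).2

/-- A positive functional of norm at most one whose proper convex combination with another such
functional is a state is itself a state. -/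
theorem isState_of_convexCombination {f g₁ g₂ : B →L[ℂ] ℂ} (hf : ‖f‖ = 1) (h₁ : ‖g₁‖ ≤ 1)
    (h₂ : ‖g₂‖ ≤ 1) (p₁ : ∀ a, 0 ≤ g₁ (star a * a)) (p₂ : ∀ a, 0 ≤ g₂ (star a * a)) {t : ℝ}
    (t0 : 0 < t) (t1 : t < 1) (h : f = (t : ℂ) • g₁ + ((1 : ℂ) - (t : ℂ)) • g₂) :
    IsState g₁ ∧ IsState g₂ := by
  have key : 1 ≤ t * ‖g₁‖ + (1 - t) * ‖g₂‖ := by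
    calc 1 = ‖f‖ := hf.symm
      _ ≤ ‖(t : ℂ) • g₁‖ + ‖((1 : ℂ) - (t : ℂ)) • g₂‖ := h ▸ norm_add_le _ _
      _ = t * ‖g₁‖ + (1 - t) * ‖g₂‖ := by
        have : (1 : ℂ) - (t : ℂ) = ((1 - t : ℝ) : ℂ) := by push_cast; ring
        rw [norm_smul, norm_smul, this, Complex.norm_real, Complex.norm_real,
          Real.norm_of_nonneg t0.le, Real.norm_of_nonneg (sub_pos.2 t1).le]
  refine ⟨⟨h₁.antisymm ?_, p₁⟩, ⟨h₂.antisymm ?_, p₂⟩⟩ <;> nlinarith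

end PositiveFunctionals

theorem IsState.map_one {D : Type*} [CStarAlgebra D] {φ : D →L[ℂ] ℂ} (h : IsState φ) :
    φ 1 = 1 := by
  have hp : 0 ≤ φ 1 := by simpa using h.2 1
  have him : φ 1 = ((φ 1).re : ℂ) := Complex.ext rfl (Complex.le_def.mp hp).2.symm
  have hge : ‖φ‖ ≤ √(φ 1).re := by
    refine φ.opNorm_le_bound (Real.sqrt_nonneg _) fun x => ?_
    have h1 := norm_apply_star_mul_sq_le_s4 h.2 1 x
    have h2 := re_apply_star_mul_self_le φ x
    rw [h.1, one_mul] at h2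
    simp only [star_one, one_mul] at h1
    refine le_of_sq_le_sq ?_ (by positivity)
    rw [mul_pow, Real.sq_sqrt (Complex.le_def.mp hp).1]
    exact h1.trans (mul_le_mul_of_nonneg_left h2 (Complex.le_def.mp hp).1)
  rw [h.1, Real.one_le_sqrt] at hge
  have : Nontrivial D := by
    refine ⟨1, 0, fun h0 => ?_⟩
    rw [h0] at hge
    simp at hge
    linarith
  have hle : (φ 1).re ≤ 1 := by
    have := re_apply_star_mul_self_le φ 1
    simpa [h.1] using this
  rw [him, le_antisymm hle hge, Complex.ofReal_one]

/-- A C*-algebra `D` presented as `ℂ·1 + B`, with `B` an isometrically embedded ideal on which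
the character `q` vanishes. -/
structure UnitizationPresentation (B D : Type*) [NonUnitalCStarAlgebra B] [CStarAlgebra D] where
  /-- The inclusion of the ideal. -/
  j : B →⋆ₙₐ[ℂ] D
  /-- The scalar part. -/
  q : D →⋆ₐ[ℂ] ℂ
  /-- The part in the ideal. -/
  p : D →L[ℂ] B
  isometry_j : Isometry j
  q_smul_one_add (x : D) : q x • (1 : D) + j (p x) = x
  q_j (b : B) : q (j b) = 0
  p_j (b : B) : p (j b) = b

namespace UnitizationPresentation

variable {B D : Type*} [NonUnitalCStarAlgebra B] [CStarAlgebra D]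
  (U : UnitizationPresentation B D)

/-- The inclusion as a continuous linear map. -/
def incl : B →L[ℂ] D := ⟨(U.j : B →ₗ[ℂ] D), U.isometry_j.continuous⟩

@[simp] theorem incl_apply (b : B) : U.incl b = U.j b := rfl

/-- The scalar part as a continuous linear map. -/
def scalar : D →L[ℂ] ℂ := ⟨U.q.toLinearMap, map_continuous U.q⟩

@[simp] theorem scalar_apply (x : D) : U.scalar x = U.q x := rfl

/-- The unital extension of a functional on the ideal. -/
def extend (g : B →L[ℂ] ℂ) : D →L[ℂ] ℂ := U.scalar + g.comp U.p

theorem extend_apply (g : B →L[ℂ] ℂ) (x : D) : U.extend g x = U.q x + g (U.p x) := rfl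

@[simp] theorem extend_j (g : B →L[ℂ] ℂ) (b : B) : U.extend g (U.j b) = g b := by
  simp [extend_apply, U.q_j, U.p_j]

theorem norm_j (b : B) : ‖U.j b‖ = ‖b‖ := U.isometry_j.norm_map_of_map_zero (_root_.map_zero _) b

theorem eq_of_map_one {φ ψ : D →L[ℂ] ℂ} (h1 : φ 1 = ψ 1) (h : ∀ b, φ (U.j b) = ψ (U.j b)) :
    φ = ψ := by
  ext x
  rw [← U.q_smul_one_add x]
  simp only [map_add, map_smul, h1, h]

theorem p_one : U.p 1 = 0 := by
  apply U.isometry_j.injective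
  have := U.q_smul_one_add 1
  simpa using this

theorem extend_one (g : B →L[ℂ] ℂ) : U.extend g 1 = 1 := by
  simp [extend_apply, U.p_one]

theorem eq_extend {φ : D →L[ℂ] ℂ} (h1 : φ 1 = 1) {g : B →L[ℂ] ℂ} (h : ∀ b, φ (U.j b) = g b) :
    φ = U.extend g :=
  U.eq_of_map_one (by rw [h1, extend_one]) (by simpa using h)

/-- The product `x * b` as an element of the ideal. -/
def act (x : D) (b : B) : B := U.q x • b + U.p x * b

theorem j_act (x : D) (b : B) : U.j (U.act x b) = x * U.j b := by
  conv_rhs => rw [← U.q_smul_one_add x]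
  simp [act, add_mul]

theorem norm_act_le (x : D) (b : B) : ‖U.act x b‖ ≤ ‖x‖ * ‖b‖ := by
  rw [← U.norm_j, j_act, ← U.norm_j b]
  exact norm_mul_le _ _

theorem tendsto_extend {g : B →L[ℂ] ℂ} (hg : IsState g) {l : Filter B}
    (hl : l.IsApproximateUnit) (hstar : ∀ᶠ e in l, star e = e) (hnorm : ∀ᶠ e in l, ‖e‖ ≤ 1)
    (x : D) : Tendsto (fun e => g (e * U.act x e)) l (𝓝 (U.extend g x)) := by
  have h1 : Tendsto (fun e => U.q x * g (e * e)) l (𝓝 (U.q x * 1)) :=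
    (hg.tendsto_approximateUnit_sq hl hstar hnorm).const_mul _
  have h2 : Tendsto (fun e => e * (U.p x * e)) l (𝓝 (U.p x)) := by
    have h3 : Tendsto (fun e => e * U.p x + e * (U.p x * e - U.p x)) l (𝓝 (U.p x + 0)) := by
      refine (hl.tendsto_mul_right (U.p x)).add ?_
      refine squeeze_zero_norm' (a := fun e => ‖U.p x * e - U.p x‖) ?_ ?_
      · filter_upwards [hnorm] with e he
        exact (norm_mul_le _ _).trans (mul_le_of_le_one_left (norm_nonneg _) he)
      · simpa using ((hl.tendsto_mul_left (U.p x)).sub_const (U.p x)).norm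
    simpa [mul_sub] using h3
  have h4 := h1.add ((g.continuous.tendsto _).comp h2)
  rw [mul_one] at h4
  refine h4.congr fun e => ?_
  simp [act, mul_add, mul_smul_comm]

theorem isState_extend {g : B →L[ℂ] ℂ} (hg : IsState g) : IsState (U.extend g) := by
  obtain ⟨l, hl, hstar, hnorm⟩ := exists_selfAdjoint_approximateUnit B
  have := hl.neBot
  refine ⟨le_antisymm ?_ ?_, fun x => ?_⟩
  · refine (U.extend g).opNorm_le_bound zero_le_one fun x => ?_
    refine le_of_tendsto (U.tendsto_extend hg hl hstar hnorm x).norm ?_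
    filter_upwards [hnorm] with e he
    calc ‖g (e * U.act x e)‖ ≤ ‖g‖ * ‖e * U.act x e‖ := g.le_opNorm _
      _ = ‖e * U.act x e‖ := by rw [hg.1, one_mul]
      _ ≤ ‖e‖ * (‖x‖ * ‖e‖) := (norm_mul_le _ _).trans (by gcongr; exact U.norm_act_le x e)
      _ ≤ 1 * (‖x‖ * 1) := by gcongr
      _ = 1 * ‖x‖ := by rw [mul_one]
  · rw [← hg.1]
    refine g.opNorm_le_bound (norm_nonneg _) fun b => ?_
    rw [← U.extend_j g b, ← U.norm_j b]
    exact (U.extend g).le_opNorm _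
  · refine ge_of_tendsto (U.tendsto_extend hg hl hstar hnorm (star x * x)) ?_
    filter_upwards [hstar] with e he
    have : e * U.act (star x * x) e = star (U.act x e) * U.act x e := by
      apply U.isometry_j.injective
      simp only [map_mul, map_star, j_act, star_mul]
      rw [← map_star, he]
      simp only [mul_assoc]
    rw [this]
    exact hg.2 _

theorem isState_scalar : IsState U.scalar := by
  have : Nontrivial D := U.q.toRingHom.domain_nontrivial
  refine ⟨le_antisymm (U.scalar.opNorm_le_bound zero_le_one fun x => ?_) ?_, fun x => ?_⟩
  · simpa using NonUnitalStarAlgHom.norm_apply_le U.q x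
  · simpa using U.scalar.le_opNorm 1
  · rw [scalar_apply, map_mul, map_star]
    exact star_mul_self_nonneg (U.q x)

theorem norm_comp_incl_le (φ : D →L[ℂ] ℂ) : ‖φ.comp U.incl‖ ≤ ‖φ‖ := by
  refine ContinuousLinearMap.opNorm_le_bound _ (norm_nonneg _) fun b => ?_
  rw [← U.norm_j b]
  exact φ.le_opNorm _

theorem comp_incl_nonneg {φ : D →L[ℂ] ℂ} (h : IsState φ) (b : B) :
    0 ≤ φ.comp U.incl (star b * b) := by
  rw [ContinuousLinearMap.comp_apply, incl_apply, map_mul, map_star]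
  exact h.2 (U.j b)

/-- The quotient map onto the scalars is a pure state. -/
theorem isPureState_scalar : IsPureState U.scalar := by
  refine ⟨U.isState_scalar, fun ψ₁ ψ₂ t h₁ h₂ t0 t1 h => ?_⟩
  have zero_of_sq (ψ : D →L[ℂ] ℂ) (hψ : IsState ψ)
      (h0 : ∀ b, (ψ (U.j (star b * b))).re ≤ 0) : ψ = U.scalar := by
    refine U.eq_of_map_one (by simp [hψ.map_one]) fun b => ?_
    have hc := norm_apply_star_mul_sq_le_s4 hψ.2 1 (U.j b)
    have hb := h0 b
    simp only [star_one, one_mul, hψ.map_one, Complex.one_re, map_mul, map_star] at hc hb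
    have : ‖ψ (U.j b)‖ = 0 := by nlinarith [norm_nonneg (ψ (U.j b))]
    simpa [U.q_j] using this
  have hsum (b : B) : 0 = t * (ψ₁ (U.j (star b * b))).re +
      (1 - t) * (ψ₂ (U.j (star b * b))).re := by
    have := congrArg Complex.re (DFunLike.congr_fun h (U.j (star b * b)))
    rw [scalar_apply, U.q_j] at this
    simpa using this
  have hn₁ (b : B) := (Complex.le_def.mp (U.comp_incl_nonneg h₁ b)).1
  have hn₂ (b : B) := (Complex.le_def.mp (U.comp_incl_nonneg h₂ b)).1
  simp only [Complex.zero_re, ContinuousLinearMap.comp_apply, incl_apply] at hn₁ hn₂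
  have hs := sub_pos.2 t1
  constructor
  · refine zero_of_sq _ h₁ fun b => ?_
    nlinarith [hsum b, hn₁ b, mul_nonneg hs.le (hn₂ b)]
  · refine zero_of_sq _ h₂ fun b => ?_
    nlinarith [hsum b, hn₂ b, mul_nonneg t0.le (hn₁ b)]

/-- The unital extension of a pure state is pure. -/
theorem isPureState_extend {g : B →L[ℂ] ℂ} (hg : IsPureState g) : IsPureState (U.extend g) := by
  refine ⟨U.isState_extend hg.1, fun ψ₁ ψ₂ t h₁ h₂ t0 t1 h => ?_⟩
  have hc : g = (t : ℂ) • ψ₁.comp U.incl + ((1 : ℂ) - (t : ℂ)) • ψ₂.comp U.incl := by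
    ext b
    simpa using DFunLike.congr_fun h (U.j b)
  obtain ⟨s₁, s₂⟩ := isState_of_convexCombination hg.1.1
    ((U.norm_comp_incl_le ψ₁).trans h₁.1.le) ((U.norm_comp_incl_le ψ₂).trans h₂.1.le)
    (U.comp_incl_nonneg h₁) (U.comp_incl_nonneg h₂) t0 t1 hc
  obtain ⟨e₁, e₂⟩ := hg.2 _ _ t s₁ s₂ t0 t1 hc
  exact ⟨U.eq_extend h₁.map_one (DFunLike.congr_fun e₁),
    U.eq_extend h₂.map_one (DFunLike.congr_fun e₂)⟩

/-- A pure state which does not vanish on the ideal restricts to a pure state of it. -/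
theorem isPureState_comp_incl {φ : D →L[ℂ] ℂ} (hφ : IsPureState φ) (h0 : φ.comp U.incl ≠ 0) :
    IsPureState (φ.comp U.incl) := by
  set f := φ.comp U.incl with hf
  have hfle : ‖f‖ ≤ 1 := (U.norm_comp_incl_le φ).trans hφ.1.1.le
  have hpos : 0 < ‖f‖ := norm_pos_iff.2 h0
  have hφe : φ = U.extend f := U.eq_extend hφ.1.map_one fun b => rfl
  have hnorm : ‖f‖ = 1 := by
    refine hfle.antisymm (not_lt.1 fun hlt => h0 ?_)
    have hne : (‖f‖ : ℂ) ≠ 0 := by exact_mod_cast hpos.ne'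
    have hg : IsState ((‖f‖ : ℂ)⁻¹ • f) := by
      refine ⟨by rw [norm_smul]; simp [hpos.ne'], fun a => ?_⟩
      have hinv : (0 : ℂ) ≤ (‖f‖ : ℂ)⁻¹ := by
        rw [← Complex.ofReal_inv]
        exact_mod_cast inv_nonneg.2 hpos.le
      exact mul_nonneg hinv (U.comp_incl_nonneg hφ.1 a)
    have := (hφ.2 (U.extend ((‖f‖ : ℂ)⁻¹ • f)) U.scalar ‖f‖ (U.isState_extend hg)
      U.isState_scalar hpos hlt ?_).2
    · rw [hf, ← this]
      ext b
      simp [U.q_j]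
    · refine U.eq_of_map_one ?_ fun b => ?_
      · simp [hφ.1.map_one, U.extend_one]
      · rw [hφe]
        simp [U.q_j, hne]
  refine ⟨⟨hnorm, U.comp_incl_nonneg hφ.1⟩, fun g₁ g₂ t h₁ h₂ t0 t1 h => ?_⟩
  obtain ⟨e₁, e₂⟩ := hφ.2 (U.extend g₁) (U.extend g₂) t (U.isState_extend h₁)
    (U.isState_extend h₂) t0 t1 (by
      refine U.eq_of_map_one ?_ fun b => ?_
      · simp [hφ.1.map_one, U.extend_one]
      · simpa [hf] using DFunLike.congr_fun h b)
  constructor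
  · ext b
    rw [hf, ← e₁]
    simp
  · ext b
    rw [hf, ← e₂]
    simp

end UnitizationPresentation

/-- The standard presentation of the unitization of a C*-algebra. -/
def unitizationPresentation (A : Type*) [NonUnitalCStarAlgebra A] :
    UnitizationPresentation A (Unitization ℂ A) where
  j := Unitization.inrNonUnitalStarAlgHom ℂ A
  q := { Unitization.fstHom ℂ A with map_star' := fun _ => rfl }
  p := ⟨Unitization.sndHom ℂ ℂ A, Unitization.continuous_snd⟩
  isometry_j := Unitization.isometry_inr
  q_smul_one_add x := by
    ext
    · change x.fst * 1 + 0 = x.fst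
      simp
    · change x.fst • (0 : A) + x.snd = x.snd
      simp
  q_j _ := rfl
  p_j _ := rfl

section Masa

variable {A : Type*} [NonUnitalCStarAlgebra A] {C : NonUnitalStarSubalgebra ℂ A}

theorem IsMasa.isClosed (h : IsMasa C) : IsClosed (C : Set A) := by
  have : (C : Set A) = ⋂ c ∈ C, {x | c * x = x * c} := by
    ext x
    simp only [SetLike.mem_coe, Set.mem_iInter, Set.mem_ofPred_eq]
    exact ⟨fun hx c hc => h.1 c hc x hx, h.2 x⟩
  rw [this]
  exact isClosed_biInter fun c _ => isClosed_eq (by fun_prop) (by fun_prop)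

variable (C) in
theorem mem_adjoin_map_inr_iff {x : Unitization ℂ A} :
    x ∈ StarAlgebra.adjoin ℂ
      ((C.map (Unitization.inrNonUnitalStarAlgHom ℂ A)) : Set (Unitization ℂ A)) ↔
      x.snd ∈ C := by
  constructor
  · intro hx
    induction hx using StarAlgebra.adjoin_induction with
    | mem x hx =>
      obtain ⟨c, hc, rfl⟩ := hx
      exact hc
    | algebraMap r => exact C.zero_mem
    | add x y _ _ hx hy => exact C.add_mem hx hy
    | mul x y _ _ hx hy =>
      exact C.add_mem (C.add_mem (SMulMemClass.smul_mem _ hy) (SMulMemClass.smul_mem _ hx)) (C.mul_mem hx hy)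
    | star x _ hx => exact star_mem hx
  · intro hx
    rw [← Unitization.inl_fst_add_inr_snd_eq x]
    exact add_mem (algebraMap_mem _ x.fst) (StarAlgebra.subset_adjoin ℂ _ ⟨x.snd, hx, rfl⟩)

theorem IsMasa.isMasaU_adjoin (h : IsMasa C) :
    IsMasaU (StarAlgebra.adjoin ℂ
      ((C.map (Unitization.inrNonUnitalStarAlgHom ℂ A)) : Set (Unitization ℂ A))) := by
  refine ⟨fun x hx y hy => ?_, fun x hx => ?_⟩
  · rw [mem_adjoin_map_inr_iff] at hx hy
    ext
    · simp [mul_comm]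
    · simp only [Unitization.snd_mul, h.1 _ hx _ hy]
      abel
  · rw [mem_adjoin_map_inr_iff]
    refine h.2 _ fun c hc => ?_
    have := congrArg (Unitization.sndHom ℂ ℂ A) (hx (c : Unitization ℂ A) ((mem_adjoin_map_inr_iff C).2 hc))
    simpa using this

variable (C) in
theorem isClosed_adjoin_map_inr [hC : IsClosed (C : Set A)] :
    IsClosed (StarAlgebra.adjoin ℂ
      ((C.map (Unitization.inrNonUnitalStarAlgHom ℂ A)) : Set (Unitization ℂ A)) :
        Set (Unitization ℂ A)) := by
  have := hC.preimage (Unitization.continuous_snd (𝕜 := ℂ) (A := A))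
  convert this using 1
  ext x
  exact mem_adjoin_map_inr_iff C

variable (C) in
/-- The presentation of `C + ℂ·1` inside the unitization of the ambient algebra. -/
def adjoinPresentation [IsClosed (C : Set A)]
    [IsClosed (StarAlgebra.adjoin ℂ
      ((C.map (Unitization.inrNonUnitalStarAlgHom ℂ A)) : Set (Unitization ℂ A)) :
        Set (Unitization ℂ A))] :
    UnitizationPresentation C (StarAlgebra.adjoin ℂ
      ((C.map (Unitization.inrNonUnitalStarAlgHom ℂ A)) : Set (Unitization ℂ A))) where
  j :=
    { toFun := fun c => ⟨(c : A), (mem_adjoin_map_inr_iff C).2 c.2⟩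
      map_smul' := fun _ _ => Subtype.ext (Unitization.inr_smul _ _ _)
      map_zero' := Subtype.ext (Unitization.inr_zero _)
      map_add' := fun _ _ => Subtype.ext (Unitization.inr_add _ _ _)
      map_mul' := fun _ _ => Subtype.ext (Unitization.inr_mul _ _ _)
      map_star' := fun _ => Subtype.ext (Unitization.inr_star _) }
  q := (unitizationPresentation A).q.comp (StarSubalgebra.subtype _)
  p :=
    { toFun := fun x => ⟨(x : Unitization ℂ A).snd, (mem_adjoin_map_inr_iff C).1 x.2⟩
      map_add' := fun _ _ => rfl
      map_smul' := fun _ _ => rfl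
      cont := (Unitization.continuous_snd.comp continuous_subtype_val).subtype_mk _ }
  isometry_j := Isometry.of_dist_eq fun c d => Unitization.isometry_inr.dist_eq (c : A) (d : A)
  q_smul_one_add x := Subtype.ext ((unitizationPresentation A).q_smul_one_add x)
  q_j _ := rfl
  p_j _ := rfl

end Masa

/-- if `C` is a masa with the extension property of a non-unital
C*-algebra `A`, then `C̃ = C + ℂ·1` is a masa of the unitization `Ã` with the
extension property. -/
theorem stmt_4 {A : Type*} [NonUnitalCStarAlgebra A]
    (hA : ¬∃ e : A, ∀ a : A, e * a = a ∧ a * e = a)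
    (C : NonUnitalStarSubalgebra ℂ A) (hmasa : IsMasa C)
    (hext : HasExtensionProperty C) :
    IsMasaU (StarAlgebra.adjoin ℂ
      ((C.map (Unitization.inrNonUnitalStarAlgHom ℂ A)) : Set (Unitization ℂ A))) ∧
    HasExtensionPropertyU (StarAlgebra.adjoin ℂ
      ((C.map (Unitization.inrNonUnitalStarAlgHom ℂ A)) : Set (Unitization ℂ A))) := by
  refine ⟨hmasa.isMasaU_adjoin, fun χ hχ => ?_⟩
  have : IsClosed (C : Set A) := hmasa.isClosed
  have := isClosed_adjoin_map_inr C
  let U := unitizationPresentation A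
  let V := adjoinPresentation C
  have ext_iff (φ : Unitization ℂ A →L[ℂ] ℂ) (hφ : IsPureState φ) :
      (∀ c : StarAlgebra.adjoin ℂ
        ((C.map (Unitization.inrNonUnitalStarAlgHom ℂ A)) : Set (Unitization ℂ A)),
          φ ↑c = χ c) ↔ ∀ c : C, φ.comp U.incl c = χ.comp V.incl c := by
    refine ⟨fun h c => h (V.j c), fun h c => ?_⟩
    have h1 : χ = V.extend (χ.comp V.incl) := V.eq_extend hχ.1.map_one fun _ => rfl
    have h2 : φ = U.extend (φ.comp U.incl) := U.eq_extend hφ.1.map_one fun _ => rfl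
    rw [h1, h2, V.extend_apply, U.extend_apply, ← h]
    rfl
  by_cases h0 : χ.comp V.incl = 0
  · refine ⟨U.scalar, ⟨U.isPureState_scalar, (ext_iff _ U.isPureState_scalar).2 fun c => ?_⟩,
      fun ψ ⟨hψ, hψχ⟩ => ?_⟩
    · rw [h0]
      exact U.q_j c
    · rw [ext_iff ψ hψ] at hψχ
      have hz : ψ.comp U.incl = 0 := by
        by_contra hne
        obtain ⟨c, hc, hc0⟩ := hext.2 _ (U.isPureState_comp_incl hψ hne)
        exact hc0 ((hψχ ⟨c, hc⟩).trans (by rw [h0]; rfl))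
      refine U.eq_of_map_one (by simp [hψ.1.map_one]) fun b => ?_
      rw [U.scalar_apply, U.q_j]
      exact DFunLike.congr_fun hz b
  · obtain ⟨φ, ⟨hφ, hφχ⟩, huniq⟩ := hext.1 _ (V.isPureState_comp_incl hχ h0)
    have hφe := U.isPureState_extend hφ
    refine ⟨U.extend φ, ⟨hφe, (ext_iff _ hφe).2 fun c => ?_⟩, fun ψ ⟨hψ, hψχ⟩ => ?_⟩
    · rw [← hφχ]
      exact U.extend_j φ c
    · rw [ext_iff ψ hψ] at hψχ
      have hne : ψ.comp U.incl ≠ 0 := by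
        intro hz
        apply h0
        ext c
        rw [← hψχ, hz]
        rfl
      have := huniq _ ⟨U.isPureState_comp_incl hψ hne, hψχ⟩
      exact U.eq_extend hψ.1.map_one (DFunLike.congr_fun this)
end
end
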